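/- arXiv:1704.03625 — 3 statements merged into one kernel-verified Lean document; each statement's English description precedes it below -/
import Mathlib

section
/- Let p ∈ [1,∞) and δ, δ' ≥ 0 satisfy d − d_H + min(δ,δ') − p > 0, and set a_p = (d − d_H + min(δ,δ') − p)/p. Then for every φ ∈ C_c^1(Ω) one has ∫_Ω c_Ω |∇φ|^p ≥ ∫_Ω c_Ω |(∇d_Γ)·(∇φ)|^p ≥ a_p^p ∫_Ω c_Ω d_Γ^{−p} |φ|^p. -/
open MeasureTheory Set
open scoped RealInnerProductSpace

noncomputable section

namespace HardyAux

section proj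
variable {E : Type*} [NormedAddCommGroup E] [InnerProductSpace ℝ E]

theorem abs_det_le [FiniteDimensional ℝ E] (f : E →ₗ[ℝ] E) (hf : ∀ v, ‖f v‖ ≤ ‖v‖)
    (W : Submodule ℝ E) (s : ℝ) (hs : 0 ≤ s) (hW : ∀ w ∈ W, f w = s • w) :
    |LinearMap.det f| ≤ s ^ Module.finrank ℝ W := by
  classical
  set n := Module.finrank ℝ E with hn
  set k := Module.finrank ℝ W with hk
  have hkn : k ≤ n := Submodule.finrank_le W
  let c := stdOrthonormalBasis ℝ W
  let v : Fin n → E := fun i => if h : (i : ℕ) < k then (c ⟨i, h⟩ : E) else 0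
  let S : Set (Fin n) := {i | (i : ℕ) < k}
  have hv : Orthonormal ℝ (S.domRestrict v) := by
    have h1 : Orthonormal ℝ (fun i : Fin k => (c i : E)) :=
      c.orthonormal.comp_linearIsometry W.subtypeₗᵢ
    have h2 := h1.comp (fun i : S => (⟨(i : Fin n), i.2⟩ : Fin k)) (by
      intro a b hab
      apply Subtype.ext
      apply Fin.ext
      simpa using hab)
    convert! h2 using 1
    funext i
    have : ((i : Fin n) : ℕ) < k := i.2
    simp [v, this, Set.domRestrict]
  obtain ⟨b, hb⟩ := hv.exists_orthonormalBasis_extension_of_card_eq (by simp [hn])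
  have : Fact (Module.finrank ℝ E = n) := ⟨rfl⟩
  have h3 := (b.toBasis.orientation).abs_volumeForm_apply_le (f ∘ b)
  rw [Orientation.volumeForm_robust _ b rfl] at h3
  have h4 := b.toBasis.det_comp f b
  have h5 : b.toBasis.det b = 1 := by
    have := b.toBasis.det_self
    simpa using this
  rw [h5, mul_one] at h4
  rw [h4] at h3
  refine h3.trans ?_
  calc ∏ i : Fin n, ‖(f ∘ b) i‖ ≤ ∏ i : Fin n, (if (i : ℕ) < k then s else 1) := by
        apply Finset.prod_le_prod
        · intros; positivity
        · intro i _
          split_ifs with h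
          · have : b i ∈ W := by
              rw [hb i h]; simp [v, h]
            simp only [Function.comp]
            rw [hW _ this, norm_smul, b.norm_eq_one, mul_one, Real.norm_eq_abs, abs_of_nonneg hs]
          · simpa using hf (b i)
    _ = s ^ k := by
        rw [Finset.prod_ite]
        simp only [Finset.prod_const, one_pow, mul_one]
        congr 1
        rw [← Fintype.card_subtype]
        refine Eq.trans (Fintype.card_congr ?_) (Fintype.card_fin k)
        exact ⟨fun i => ⟨i.1, i.2⟩, fun i => ⟨⟨i, i.2.trans_le hkn⟩, i.2⟩, fun _ => rfl, fun _ => rfl⟩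

theorem le_abs_det [FiniteDimensional ℝ E] (f : E →ₗ[ℝ] E) (hf : ∀ v, ‖v‖ ≤ ‖f v‖)
    (W : Submodule ℝ E) (t : ℝ) (ht : 0 < t) (hW : ∀ w ∈ W, f w = t • w) :
    t ^ Module.finrank ℝ W ≤ |LinearMap.det f| := by
  have hinj : Function.Injective f := by
    rw [injective_iff_map_eq_zero]
    intro a ha
    have := hf a
    rw [ha, norm_zero] at this
    exact norm_le_zero_iff.1 this
  let e := LinearEquiv.ofInjectiveEndo f hinj
  have he : ∀ x, e x = f x := fun x => rfl
  have h1 := abs_det_le (e.symm : E →ₗ[ℝ] E) (fun v => by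
    have := hf (e.symm v)
    rwa [← he, e.apply_symm_apply] at this) W t⁻¹ (by positivity) (fun w hw => by
      change e.symm w = _
      rw [LinearEquiv.symm_apply_eq, map_smul, he, hW w hw, smul_smul, inv_mul_cancel₀ ht.ne', one_smul])
  have h2 : LinearMap.det (e.symm : E →ₗ[ℝ] E) * LinearMap.det f = 1 := by
    exact e.det_symm_mul_det
  have h3 : |LinearMap.det (e.symm : E →ₗ[ℝ] E)| * |LinearMap.det f| = 1 := by
    rw [← abs_mul, h2, abs_one]
  rw [inv_pow] at h1
  have h4 : 0 < t ^ Module.finrank ℝ W := by positivity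
  have h5 : (1:ℝ) ≤ (t ^ Module.finrank ℝ W)⁻¹ * |LinearMap.det f| := by
    rw [← h3]; gcongr
  rw [inv_mul_eq_div, le_div_iff₀ h4] at h5
  linarith

/-- `P` is the metric projection onto `K`. -/
structure IsProj (K : Set E) (P : E → E) : Prop where
  mem : ∀ x, P x ∈ K
  le : ∀ x, ∀ k ∈ K, ⟪x - P x, k - P x⟫ ≤ 0

theorem exists_isProj [CompleteSpace E] {K : Set E} (h1 : K.Nonempty) (h2 : IsClosed K)
    (h3 : Convex ℝ K) : ∃ P, IsProj K P := by
  choose P hP hP' using exists_norm_eq_iInf_of_complete_convex h1 h2.isComplete h3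
  exact ⟨P, hP, fun x => (norm_eq_iInf_iff_real_inner_le_zero h3 (hP x)).1 (hP' x)⟩

variable {K : Set E} {P : E → E}

theorem IsProj.lip (h : IsProj K P) : LipschitzWith 1 P := by
  apply LipschitzWith.of_dist_le_mul
  intro x y
  rw [dist_eq_norm, dist_eq_norm, NNReal.coe_one, one_mul]
  have h1 := h.le x _ (h.mem y)
  have h2 := h.le y _ (h.mem x)
  have h3 : ‖P x - P y‖ ^ 2 ≤ ⟪x - y, P x - P y⟫ := by
    have e : x - y = (x - P x) - (y - P y) + (P x - P y) := by abel
    have e1 : P y - P x = -(P x - P y) := by abel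
    rw [e1, inner_neg_right] at h1
    rw [e, inner_add_left, inner_sub_left, real_inner_self_eq_norm_sq]
    linarith
  have h4 := real_inner_le_norm (x - y) (P x - P y)
  by_contra! h5
  nlinarith [norm_nonneg (x - y), norm_nonneg (P x - P y)]

theorem IsProj.unique (h : IsProj K P) {x q : E} (hq : q ∈ K) (hle : ∀ k ∈ K, ⟪x - q, k - q⟫ ≤ 0) :
    P x = q := by
  have h1 := h.le x _ hq
  have h2 := hle _ (h.mem x)
  have : ‖P x - q‖ ^ 2 ≤ 0 := by
    rw [← real_inner_self_eq_norm_sq]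
    have e : ⟪P x - q, P x - q⟫ = ⟪x - q, P x - q⟫ + ⟪x - P x, q - P x⟫ := by
      have e1 : q - P x = -(P x - q) := by abel
      rw [e1, inner_neg_right, ← sub_eq_add_neg, ← inner_sub_left]
      congr 1; abel
    rw [e]; linarith
  have : ‖P x - q‖ = 0 := by nlinarith [norm_nonneg (P x - q)]
  exact sub_eq_zero.1 (norm_eq_zero.1 this)

theorem IsProj.infDist (h : IsProj K P) (x : E) : Metric.infDist x K = ‖x - P x‖ := by
  apply le_antisymm
  · rw [← dist_eq_norm]
    exact Metric.infDist_le_dist_of_mem (h.mem x)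
  · rw [Metric.le_infDist ⟨_, h.mem x⟩]
    intro k hk
    rw [dist_eq_norm]
    have h1 := h.le x k hk
    have e : ‖x - k‖ ^ 2 = ‖x - P x‖ ^ 2 - 2 * ⟪x - P x, k - P x⟫ + ‖k - P x‖ ^ 2 := by
      rw [← norm_sub_sq_real]; congr 2; abel
    apply le_of_sq_le_sq _ (norm_nonneg _)
    nlinarith [sq_nonneg ‖k - P x‖]

theorem IsProj.eq_self_iff (h : IsProj K P) {x : E} : x - P x = 0 ↔ x ∈ K := by
  constructor
  · intro hx; rw [sub_eq_zero.1 hx]; exact h.mem x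
  · intro hx; rw [h.unique hx (by simp), sub_self]

/-- dilation -/
def T (P : E → E) (t : ℝ) (x : E) : E := P x + t • (x - P x)

theorem IsProj.proj_T (h : IsProj K P) {t : ℝ} (ht : 0 ≤ t) (x : E) : P (T P t x) = P x := by
  apply h.unique (h.mem x)
  intro k hk
  rw [T, add_sub_cancel_left, inner_smul_left]
  exact mul_nonpos_of_nonneg_of_nonpos ht (h.le x k hk)

theorem IsProj.T_sub (h : IsProj K P) {t : ℝ} (ht : 0 ≤ t) (x : E) :
    T P t x - P (T P t x) = t • (x - P x) := by
  rw [h.proj_T ht, T, add_sub_cancel_left]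

theorem IsProj.T_mem (h : IsProj K P) {t : ℝ} (ht : 0 < t) {x : E} (hx : x ∈ Kᶜ) :
    T P t x ∈ Kᶜ := by
  intro h1
  rw [← h.eq_self_iff, h.T_sub ht.le, smul_eq_zero, h.eq_self_iff] at h1
  exact h1.elim ht.ne' hx

theorem IsProj.T_inj (h : IsProj K P) {t : ℝ} (ht : 0 < t) : Function.Injective (T P t) := by
  intro x y hxy
  have h1 := h.T_sub ht.le x
  have h2 := h.T_sub ht.le y
  have h3 : P x = P y := by rw [← h.proj_T ht.le x, ← h.proj_T ht.le y, hxy]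
  rw [hxy, h2] at h1
  have h4 := smul_right_injective E ht.ne' h1
  simp only [h3] at h4
  exact (sub_left_inj.1 h4).symm

theorem IsProj.hasGradientAt [CompleteSpace E] (h : IsProj K P) {x : E} (hx : x ∈ Kᶜ) :
    HasGradientAt (fun y => Metric.infDist y K) (‖x - P x‖⁻¹ • (x - P x)) x := by
  set u := x - P x with hu
  have hu0 : u ≠ 0 := fun h0 => hx (h.eq_self_iff.1 h0)
  have hn : 0 < ‖u‖ := norm_pos_iff.2 hu0
  rw [hasGradientAt_iff_isLittleO]
  have key : ∀ y, |Metric.infDist y K - Metric.infDist x K - ⟪‖u‖⁻¹ • u, y - x⟫|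
      ≤ (2 * ‖u‖)⁻¹ * ‖y - x‖ ^ 2 := by
    intro y
    rw [h.infDist x, ← hu, inner_smul_left]
    simp only [conj_trivial]
    have lower : ‖u‖ + ‖u‖⁻¹ * ⟪u, y - x⟫ ≤ Metric.infDist y K := by
      rw [h.infDist y]
      have h1 := h.le x _ (h.mem y)
      have h2 := real_inner_le_norm u (y - P y)
      have e : ⟪u, y - P y⟫ = ⟪u, y - x⟫ + ‖u‖ ^ 2 - ⟪u, P y - P x⟫ := by
        rw [← real_inner_self_eq_norm_sq, ← inner_add_right, ← inner_sub_right]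
        congr 1; rw [hu]; abel
      rw [← hu] at h1
      have h3 : ‖u‖ * (‖u‖ + ‖u‖⁻¹ * ⟪u, y - x⟫) ≤ ‖u‖ * ‖y - P y‖ := by
        have : ‖u‖ * (‖u‖ + ‖u‖⁻¹ * ⟪u, y - x⟫) = ‖u‖ ^ 2 + ⟪u, y - x⟫ := by
          field_simp
        rw [this]; linarith
      exact le_of_mul_le_mul_left h3 hn
    have upper : Metric.infDist y K ≤ ‖u‖ + ‖u‖⁻¹ * ⟪u, y - x⟫ + (2 * ‖u‖)⁻¹ * ‖y - x‖ ^ 2 := by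
      have h1 : Metric.infDist y K ≤ ‖y - P x‖ := by
        rw [← dist_eq_norm]; exact Metric.infDist_le_dist_of_mem (h.mem x)
      have e : ‖y - P x‖ ^ 2 = ‖u‖ ^ 2 + 2 * ⟪u, y - x⟫ + ‖y - x‖ ^ 2 := by
        rw [← norm_add_sq_real]; congr 2; rw [hu]; abel
      refine h1.trans ?_
      have e2 : ‖u‖ + ‖u‖⁻¹ * ⟪u, y - x⟫ + (2 * ‖u‖)⁻¹ * ‖y - x‖ ^ 2
         = (‖u‖ ^ 2 + ‖y - P x‖ ^ 2) / (2 * ‖u‖) := by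
        rw [e]; field_simp; ring
      rw [e2, le_div_iff₀ (by positivity)]
      nlinarith [sq_nonneg (‖u‖ - ‖y - P x‖)]
    rw [abs_le]
    constructor
    · have : 0 ≤ (2 * ‖u‖)⁻¹ * ‖y - x‖ ^ 2 := by positivity
      linarith
    · linarith
  have h1 : (fun y => Metric.infDist y K - Metric.infDist x K - ⟪‖u‖⁻¹ • u, y - x⟫)
      =O[nhds x] fun y => ‖y - x‖ ^ 2 := by
    apply Asymptotics.IsBigO.of_bound (2 * ‖u‖)⁻¹
    filter_upwards with y
    rw [Real.norm_eq_abs, Real.norm_of_nonneg (by positivity)]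
    exact key y
  refine h1.trans_isLittleO ?_
  have h2 : (fun z : E => ‖z‖ ^ 2) =o[nhds 0] fun z => z := by
    exact Asymptotics.isLittleO_norm_pow_id (by norm_num)
  have h3 : Filter.Tendsto (fun y => y - x) (nhds x) (nhds 0) := by
    have : Continuous (fun y => y - x) := by fun_prop
    simpa using this.tendsto x
  exact h2.comp_tendsto h3

end proj

section cov
variable {d : ℕ} {K : Set (EuclideanSpace ℝ (Fin d))}
  {P : EuclideanSpace ℝ (Fin d) → EuclideanSpace ℝ (Fin d)}

theorem fderiv_zero {E : Type*} [NormedAddCommGroup E] [NormedSpace ℝ E] {P : E → E}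
    {B : E →L[ℝ] E} {x w : E} (hB : HasFDerivAt P B x)
    (h : ∀ᶠ s : ℝ in nhds 0, P (x + s • w) = P x) : B w = 0 := by
  have h1 : HasDerivAt (fun s : ℝ => x + s • w) w 0 := by
    have := ((hasDerivAt_id (0:ℝ)).smul_const w).const_add x
    simpa using this
  have h2 : HasDerivAt (fun s : ℝ => P (x + s • w)) (B w) 0 := by
    apply HasFDerivAt.comp_hasDerivAt (0:ℝ) _ h1
    simpa using hB
  have h3 : HasDerivAt (fun s : ℝ => P (x + s • w)) 0 0 :=
    (hasDerivAt_const (0:ℝ) (P x)).congr_of_eventuallyEq h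
  exact h2.unique h3

theorem exists_W (h : IsProj K P) {dH : ℕ} (hd : 1 ≤ d)
    (hdH : dH = min (Module.finrank ℝ (affineSpan ℝ K).direction) (d - 1))
    {x : EuclideanSpace ℝ (Fin d)} (hx : x ∈ Kᶜ)
    {B : EuclideanSpace ℝ (Fin d) →L[ℝ] EuclideanSpace ℝ (Fin d)} (hB : HasFDerivAt P B x) :
    ∃ W : Submodule ℝ (EuclideanSpace ℝ (Fin d)), Module.finrank ℝ W = d - dH ∧
      ∀ w ∈ W, B w = 0 := by
  by_cases hk : Module.finrank ℝ (affineSpan ℝ K).direction ≤ d - 1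
  · refine ⟨(affineSpan ℝ K).directionᗮ, ?_, ?_⟩
    · have := Submodule.finrank_add_finrank_orthogonal (affineSpan ℝ K).direction
      rw [finrank_euclideanSpace_fin] at this
      rw [hdH, min_eq_left hk]
      omega
    · intro w hw
      apply fderiv_zero hB
      filter_upwards with s
      apply h.unique (h.mem x)
      intro k hk
      have h1 : ⟪w, k - P x⟫ = 0 := by
        rw [real_inner_comm]
        apply hw
        exact AffineSubspace.vsub_mem_direction (subset_affineSpan ℝ K hk)
          (subset_affineSpan ℝ K (h.mem x))
      rw [add_sub_right_comm, inner_add_left, inner_smul_left, h1, mul_zero, add_zero]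
      exact h.le x k hk
  · refine ⟨Submodule.span ℝ {x - P x}, ?_, ?_⟩
    · rw [finrank_span_singleton (fun h0 => hx (h.eq_self_iff.1 h0))]
      rw [hdH, min_eq_right (by omega)]
      omega
    · intro w hw
      obtain ⟨c, rfl⟩ := Submodule.mem_span_singleton.1 hw
      rw [map_smul]
      suffices B (x - P x) = 0 by rw [this, smul_zero]
      apply fderiv_zero hB
      have : ∀ᶠ s : ℝ in nhds 0, -1 < s := lt_mem_nhds (by norm_num)
      filter_upwards [this] with s hs
      have e : x + s • (x - P x) = T P (1 + s) x := by
        rw [T, add_smul, one_smul]; abel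
      rw [e, h.proj_T (by linarith)]

theorem cov (h : IsProj K P) (hK : IsClosed K) {dH : ℕ} (hd : 1 ≤ d)
    (hdH : dH = min (Module.finrank ℝ (affineSpan ℝ K).direction) (d - 1))
    {t : ℝ} (ht : 1 ≤ t) (g : EuclideanSpace ℝ (Fin d) → ENNReal) :
    ENNReal.ofReal (t ^ (d - dH)) * ∫⁻ x in Kᶜ, g (T P t x) ≤ ∫⁻ x in Kᶜ, g x := by
  set D : Set (EuclideanSpace ℝ (Fin d)) := {x | DifferentiableAt ℝ P x} with hD
  have hDm : MeasurableSet D := measurableSet_of_differentiableAt ℝ P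
  have hKm : MeasurableSet Kᶜ := hK.measurableSet.compl
  have ht0 : 0 < t := by linarith
  have hae : (Kᶜ ∩ D : Set (EuclideanSpace ℝ (Fin d))) =ᵐ[volume]
      (Kᶜ : Set (EuclideanSpace ℝ (Fin d))) := by
    have : ∀ᵐ x ∂(volume : Measure (EuclideanSpace ℝ (Fin d))), DifferentiableAt ℝ P x :=
      h.lip.ae_differentiableAt
    filter_upwards [this] with x hx
    apply propext
    exact ⟨fun h => h.1, fun h => ⟨h, hx⟩⟩
  rw [← Measure.restrict_congr_set hae]
  let A : EuclideanSpace ℝ (Fin d) → (EuclideanSpace ℝ (Fin d) →L[ℝ] EuclideanSpace ℝ (Fin d)) :=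
    fun x => fderiv ℝ P x + t • (ContinuousLinearMap.id ℝ _ - fderiv ℝ P x)
  have hA : ∀ x ∈ Kᶜ ∩ D, HasFDerivAt (T P t) (A x) x := by
    intro x hx
    have h1 : HasFDerivAt P (fderiv ℝ P x) x := DifferentiableAt.hasFDerivAt hx.2
    exact h1.add (((hasFDerivAt_id x).sub h1).const_smul t)
  have hdet : ∀ x ∈ Kᶜ ∩ D, t ^ (d - dH) ≤ |(A x).det| := by
    intro x hx
    have h1 : HasFDerivAt P (fderiv ℝ P x) x := DifferentiableAt.hasFDerivAt hx.2
    obtain ⟨W, hW, hW'⟩ := exists_W h hd hdH hx.1 h1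
    rw [← hW]
    refine le_abs_det (A x : EuclideanSpace ℝ (Fin d) →ₗ[ℝ] EuclideanSpace ℝ (Fin d)) ?_ W t ht0 ?_
    · intro v
      have h2 := h1.le_of_lipschitz h.lip
      have h3 : ‖fderiv ℝ P x v‖ ≤ ‖v‖ := by
        have := (fderiv ℝ P x).le_of_opNorm_le h2 v
        simpa using this
      have e : t • v = A x v + (t - 1) • fderiv ℝ P x v := by
        simp only [A, add_apply, smul_apply,
          sub_apply, ContinuousLinearMap.id_apply, smul_sub, sub_smul, one_smul]
        abel
      have h4 := norm_add_le (A x v) ((t - 1) • fderiv ℝ P x v)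
      rw [← e, norm_smul, norm_smul, Real.norm_of_nonneg ht0.le,
        Real.norm_of_nonneg (by linarith)] at h4
      change ‖v‖ ≤ ‖A x v‖
      nlinarith
    · intro w hw
      change A x w = t • w
      simp [A, hW' w hw]
  have := lintegral_image_eq_lintegral_abs_det_fderiv_mul volume (hKm.inter hDm)
    (fun x hx => (hA x hx).hasFDerivWithinAt) (h.T_inj ht0).injOn g
  calc _ ≤ ∫⁻ x in Kᶜ ∩ D, ENNReal.ofReal |(A x).det| * g (T P t x) := by
        rw [← lintegral_const_mul' _ _ ENNReal.ofReal_ne_top]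
        apply setLIntegral_mono' (hKm.inter hDm)
        intro x hx
        gcongr
        exact hdet x hx
    _ = ∫⁻ x in T P t '' (Kᶜ ∩ D), g x := this.symm
    _ ≤ ∫⁻ x in Kᶜ, g x := by
        apply lintegral_mono_set
        rintro _ ⟨x, hx, rfl⟩
        exact h.T_mem ht0 hx.1
    _ = _ := by rw [Measure.restrict_congr_set hae]

end cov

section main

theorem jensen {α : Type*} [MeasurableSpace α] (ν : Measure α) [IsProbabilityMeasure ν] {p : ℝ}
    (hp : 1 ≤ p) {f : α → ENNReal} (hf : AEMeasurable f ν) :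
    (∫⁻ a, f a ∂ν) ^ p ≤ ∫⁻ a, f a ^ p ∂ν := by
  have hp0 : 0 < p := by linarith
  have h := eLpNorm'_le_eLpNorm'_of_exponent_le zero_lt_one hp ν hf.aestronglyMeasurable
  simp only [eLpNorm', enorm_eq_self, ENNReal.rpow_one, div_one] at h
  have h2 := ENNReal.rpow_le_rpow h hp0.le
  rwa [← ENNReal.rpow_mul, one_div_mul_cancel hp0.ne', ENNReal.rpow_one] at h2

/-- weight -/
def wt (δ δ' p r : ℝ) : ℝ := r ^ δ * (1 + r) ^ (δ' - δ) * r ^ (-p)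

theorem wt_le {δ δ' p r t : ℝ} (hr : 0 < r) (ht : 1 ≤ t) :
    wt δ δ' p r ≤ t ^ (p - min δ δ') * wt δ δ' p (t * r) := by
  have ht0 : 0 < t := by linarith
  have key : t ^ (min δ δ') * (1 + r) ^ (δ' - δ) ≤ t ^ δ * (1 + t * r) ^ (δ' - δ) := by
    rcases le_total δ δ' with h | h
    · rw [min_eq_left h]
      have h1 : 1 + r ≤ 1 + t * r := by nlinarith
      have := Real.rpow_le_rpow (by positivity) h1 (sub_nonneg.2 h)
      gcongr
    · rw [min_eq_right h]
      have h1 : 1 + t * r ≤ t * (1 + r) := by nlinarith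
      have h2 := Real.rpow_le_rpow_of_nonpos (by positivity) h1 (sub_nonpos.2 h)
      rw [Real.mul_rpow ht0.le (by positivity)] at h2
      calc t ^ δ' * (1 + r) ^ (δ' - δ) = t ^ δ * (t ^ (δ' - δ) * (1 + r) ^ (δ' - δ)) := by
            rw [← mul_assoc, ← Real.rpow_add ht0]; congr 2; ring
        _ ≤ _ := by gcongr
  unfold wt
  rw [Real.mul_rpow ht0.le hr.le, Real.mul_rpow ht0.le hr.le, Real.rpow_sub ht0, Real.rpow_neg ht0.le]
  have h3 : 0 < t ^ p := by positivity
  have h4 : 0 < t ^ min δ δ' := by positivity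
  calc r ^ δ * (1 + r) ^ (δ' - δ) * r ^ (-p)
      = (t ^ min δ δ' * (1 + r) ^ (δ' - δ)) * (r ^ δ * r ^ (-p) * (t ^ min δ δ')⁻¹) := by
        field_simp
    _ ≤ (t ^ δ * (1 + t * r) ^ (δ' - δ)) * (r ^ δ * r ^ (-p) * (t ^ min δ δ')⁻¹) := by gcongr
    _ = _ := by field_simp

theorem ftc {E : Type*} [NormedAddCommGroup E] [InnerProductSpace ℝ E] [ProperSpace E]
    {K : Set E} {P : E → E} (h : IsProj K P)
    {φ : E → ℝ} (hφ : ContDiff ℝ 1 φ) (hφc : HasCompactSupport φ) {x : E} (hx : x ∈ Kᶜ) :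
    ‖φ x‖ₑ ≤ ∫⁻ τ in Ici (0:ℝ), ‖fderiv ℝ φ (T P (Real.exp τ) x)
      (T P (Real.exp τ) x - P (T P (Real.exp τ) x))‖ₑ := by
  set u := x - P x with hu
  have hu0 : u ≠ 0 := fun h0 => hx (h.eq_self_iff.1 h0)
  have hn : 0 < ‖u‖ := norm_pos_iff.2 hu0
  simp_rw [h.T_sub (Real.exp_pos _).le]
  have hT : ∀ τ, T P τ x = P x + τ • u := fun τ => rfl
  simp_rw [hT, ← hu]
  have hder : ∀ τ : ℝ, HasDerivAt (fun τ => φ (P x + Real.exp τ • u))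
      (fderiv ℝ φ (P x + Real.exp τ • u) (Real.exp τ • u)) τ := by
    intro τ
    have h1 : HasDerivAt (fun τ => P x + Real.exp τ • u) (Real.exp τ • u) τ :=
      ((Real.hasDerivAt_exp τ).smul_const u).const_add (P x)
    exact ((hφ.differentiable (by norm_num)) _).hasFDerivAt.comp_hasDerivAt τ h1
  have hcont : Continuous (fun τ : ℝ => fderiv ℝ φ (P x + Real.exp τ • u) (Real.exp τ • u)) := by
    have := hφ.continuous_fderiv (by norm_num)
    fun_prop
  obtain ⟨R, hR0, hR⟩ : ∃ R : ℝ, 0 ≤ R ∧ φ (P x + Real.exp R • u) = 0 := by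
    obtain ⟨M, hM⟩ := hφc.isCompact.isBounded.exists_norm_le
    have h1 : Filter.Tendsto (fun τ => Real.exp τ * ‖u‖) Filter.atTop Filter.atTop :=
      Real.tendsto_exp_atTop.atTop_mul_const hn
    obtain ⟨R, hR1, hR2⟩ := ((h1.eventually_gt_atTop (M + ‖P x‖)).and
      (Filter.eventually_ge_atTop 0)).exists
    refine ⟨R, hR2, ?_⟩
    by_contra hne
    have h2 := hM _ (subset_tsupport φ hne)
    have h3 := norm_sub_le (P x + Real.exp R • u) (P x)
    rw [add_sub_cancel_left, norm_smul, Real.norm_of_nonneg (Real.exp_pos R).le] at h3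
    linarith
  have hint := intervalIntegral.integral_eq_sub_of_hasDerivAt (a := 0) (b := R)
    (fun τ _ => hder τ) (hcont.intervalIntegrable _ _)
  rw [hR, Real.exp_zero, one_smul, hu, add_sub_cancel, ← hu, zero_sub] at hint
  have h5 : ‖φ x‖ₑ = ‖∫ τ in (0:ℝ)..R, fderiv ℝ φ (P x + Real.exp τ • u) (Real.exp τ • u)‖ₑ := by
    rw [hint, enorm_neg]
  rw [h5, intervalIntegral.integral_of_le hR0]
  refine (enorm_integral_le_lintegral_enorm _).trans ?_
  apply lintegral_mono_set
  intro τ hτ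
  exact hτ.1.le

theorem main_lintegral {d : ℕ} {K : Set (EuclideanSpace ℝ (Fin d))}
    {P : EuclideanSpace ℝ (Fin d) → EuclideanSpace ℝ (Fin d)}
    (h : IsProj K P) (hK : IsClosed K) {dH : ℕ} (hd : 1 ≤ d)
    (hdH : dH = min (Module.finrank ℝ (affineSpan ℝ K).direction) (d - 1))
    {p δ δ' : ℝ} (hp : 1 ≤ p)
    (hcond : 0 < (d : ℝ) - dH + min δ δ' - p)
    {φ : EuclideanSpace ℝ (Fin d) → ℝ} (hφ : ContDiff ℝ 1 φ) (hφc : HasCompactSupport φ) :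
    ∫⁻ x in Kᶜ, ENNReal.ofReal (wt δ δ' p (Metric.infDist x K)) * ‖φ x‖ₑ ^ p ≤
      ENNReal.ofReal ((((d : ℝ) - dH + min δ δ' - p) / p)⁻¹) ^ p *
      ∫⁻ x in Kᶜ, ENNReal.ofReal (wt δ δ' p (Metric.infDist x K)) *
        ‖fderiv ℝ φ x (x - P x)‖ₑ ^ p := by
  set a := ((d : ℝ) - dH + min δ δ' - p) / p with ha
  have hp0 : 0 < p := by linarith
  have ha0 : 0 < a := by positivity
  have hap : a * p = (d : ℝ) - dH + min δ δ' - p := by rw [ha]; field_simp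
  have hKm : MeasurableSet Kᶜ := hK.measurableSet.compl
  have hPc : Continuous P := h.lip.continuous
  have hφ' := hφ.continuous_fderiv (by norm_num)
  set ψ : EuclideanSpace ℝ (Fin d) → ℝ := fun x => fderiv ℝ φ x (x - P x) with hψ
  have hψc : Continuous ψ := by fun_prop
  set w : EuclideanSpace ℝ (Fin d) → ENNReal :=
    fun x => ENNReal.ofReal (wt δ δ' p (Metric.infDist x K)) with hw
  have hwm : Measurable w := by
    have : Measurable fun x : EuclideanSpace ℝ (Fin d) => Metric.infDist x K :=
      (Metric.continuous_infDist_pt K).measurable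
    simp only [hw, wt]
    fun_prop
  have hTc : Continuous fun q : EuclideanSpace ℝ (Fin d) × ℝ => T P (Real.exp q.2) q.1 := by
    unfold T; fun_prop
  set G := ∫⁻ x in Kᶜ, w x * ‖ψ x‖ₑ ^ p with hG
  have hdm : ((d - dH : ℕ) : ℝ) = (d : ℝ) - dH := by
    rw [Nat.cast_sub]
    rw [hdH]; exact (min_le_right _ _).trans (Nat.sub_le _ _)
  have inner : ∀ t : ℝ, 1 ≤ t →
      ENNReal.ofReal (t ^ (a * p)) * ∫⁻ x in Kᶜ, w x * ‖ψ (T P t x)‖ₑ ^ p ≤ G := by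
    intro t ht
    have ht0 : 0 < t := by linarith
    refine le_trans ?_ (cov h hK hd hdH ht _)
    have h1 : ∫⁻ x in Kᶜ, w x * ‖ψ (T P t x)‖ₑ ^ p ≤
        ENNReal.ofReal (t ^ (p - min δ δ')) * ∫⁻ x in Kᶜ, w (T P t x) * ‖ψ (T P t x)‖ₑ ^ p := by
      rw [← lintegral_const_mul' _ _ ENNReal.ofReal_ne_top]
      apply setLIntegral_mono' hKm
      intro x hx
      rw [← mul_assoc]
      gcongr
      simp only [hw]
      rw [← ENNReal.ofReal_mul (by positivity)]
      apply ENNReal.ofReal_le_ofReal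
      have e : Metric.infDist (T P t x) K = t * Metric.infDist x K := by
        rw [h.infDist, h.T_sub ht0.le, norm_smul, h.infDist, Real.norm_of_nonneg ht0.le]
      rw [e]
      apply wt_le _ ht
      rw [h.infDist]
      exact norm_pos_iff.2 fun h0 => hx (h.eq_self_iff.1 h0)
    calc _ ≤ _ := mul_le_mul_right h1 _
      _ = _ := by
        rw [← mul_assoc, ← ENNReal.ofReal_mul (by positivity), ← Real.rpow_add ht0, hap]
        congr 2
        rw [← Real.rpow_natCast, hdm]
        congr 1; ring_nf
  let ν : Measure ℝ := volume.withDensity (ProbabilityTheory.exponentialPDF a)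
  have hpm : Measurable (ProbabilityTheory.exponentialPDF a) :=
    (ProbabilityTheory.measurable_exponentialPDFReal a).ennreal_ofReal
  have hν : IsProbabilityMeasure ν :=
    ⟨by simp [ν, ProbabilityTheory.lintegral_exponentialPDF_eq_one ha0]⟩
  have hνae : ∀ᵐ τ ∂ν, 0 ≤ τ := by
    rw [ae_withDensity_iff hpm]
    filter_upwards with τ hτ
    by_contra! hneg
    exact hτ (ProbabilityTheory.exponentialPDF_of_neg hneg)
  let F : EuclideanSpace ℝ (Fin d) → ℝ → ENNReal := fun x τ =>
    ENNReal.ofReal (a⁻¹ * Real.exp (a * τ)) * ‖ψ (T P (Real.exp τ) x)‖ₑ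
  have hψT : Continuous fun q : EuclideanSpace ℝ (Fin d) × ℝ => ψ (T P (Real.exp q.2) q.1) :=
    hψc.comp hTc
  have hFm : Measurable (Function.uncurry F) := by
    refine Measurable.mul (f := fun q : EuclideanSpace ℝ (Fin d) × ℝ =>
      ENNReal.ofReal (a⁻¹ * Real.exp (a * q.2))) ?_ (g := fun q => ‖ψ (T P (Real.exp q.2) q.1)‖ₑ) ?_
    · apply Measurable.ennreal_ofReal
      fun_prop
    · exact hψT.measurable.enorm
  have hFx : ∀ x, Measurable (F x) := fun x => hFm.of_uncurry_left
  have hpt : ∀ x ∈ Kᶜ, ‖φ x‖ₑ ^ p ≤ ∫⁻ τ, F x τ ^ p ∂ν := by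
    intro x hx
    refine le_trans ?_ (jensen ν hp (hFx x).aemeasurable)
    apply ENNReal.rpow_le_rpow _ hp0.le
    refine (ftc h hφ hφc hx).trans ?_
    rw [lintegral_withDensity_eq_lintegral_mul _ hpm (hFx x), ← lintegral_indicator measurableSet_Ici]
    apply lintegral_mono
    intro τ
    by_cases hτ : 0 ≤ τ
    · rw [indicator_of_mem (by exact hτ)]
      simp only [Pi.mul_apply, F, ProbabilityTheory.exponentialPDF_of_nonneg hτ]
      rw [← mul_assoc, ← ENNReal.ofReal_mul (by positivity)]
      have : a * Real.exp (-(a * τ)) * (a⁻¹ * Real.exp (a * τ)) = 1 := by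
        rw [Real.exp_neg]; field_simp
      rw [this, ENNReal.ofReal_one, one_mul]
    · rw [indicator_of_notMem (by exact hτ)]
      exact zero_le
  calc ∫⁻ x in Kᶜ, w x * ‖φ x‖ₑ ^ p ≤ ∫⁻ x in Kᶜ, w x * ∫⁻ τ, F x τ ^ p ∂ν := by
        apply setLIntegral_mono' hKm
        intro x hx
        gcongr
        exact hpt x hx
    _ = ∫⁻ x in Kᶜ, ∫⁻ τ, w x * F x τ ^ p ∂ν := by
        congr 1; funext x
        rw [lintegral_const_mul _ ((hFx x).pow_const p)]
    _ = ∫⁻ τ, (∫⁻ x in Kᶜ, w x * F x τ ^ p) ∂ν := by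
        apply lintegral_lintegral_swap
        apply Measurable.aemeasurable
        exact (hwm.comp measurable_fst).mul (hFm.pow_const p)
    _ ≤ ∫⁻ τ, ENNReal.ofReal (a⁻¹) ^ p * G ∂ν := by
        apply lintegral_mono_ae
        filter_upwards [hνae] with τ hτ
        refine le_trans (le_of_eq ?_) (mul_le_mul_right (inner (Real.exp τ) (Real.one_le_exp hτ)) _)
        rw [← mul_assoc, ← lintegral_const_mul' _ _ (by finiteness)]
        congr 1; funext x
        simp only [F]
        rw [ENNReal.ofReal_mul (by positivity), ENNReal.mul_rpow_of_nonneg _ _ hp0.le,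
          ENNReal.mul_rpow_of_nonneg _ _ hp0.le,
          ENNReal.ofReal_rpow_of_pos (Real.exp_pos _), ← Real.exp_mul, ← Real.exp_mul]
        have : a * τ * p = τ * (a * p) := by ring
        rw [this]; ring
    _ = _ := by simp
end main

end HardyAux

/-- Weighted Hardy inequality on the complement of a closed convex set
(Theorem 1.1 of the paper). -/
theorem hardy_inequality_complement_convex
    (d : ℕ) (hd : 1 ≤ d) (K : Set (EuclideanSpace ℝ (Fin d)))
    (hKne : K.Nonempty) (hKcl : IsClosed K) (hKconv : Convex ℝ K)
    (hKproper : K ≠ Set.univ)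
    (dH : ℕ) (hdH : dH = min (Module.finrank ℝ (affineSpan ℝ K).direction) (d - 1))
    (p δ δ' : ℝ) (hp : 1 ≤ p) (hδ : 0 ≤ δ) (hδ' : 0 ≤ δ')
    (hcond : 0 < (d : ℝ) - dH + min δ δ' - p)
    (φ : EuclideanSpace ℝ (Fin d) → ℝ) (hφ : ContDiff ℝ 1 φ)
    (hφc : HasCompactSupport φ) (hφs : tsupport φ ⊆ Kᶜ) :
    (∫ x in Kᶜ, (Metric.infDist x K ^ δ * (1 + Metric.infDist x K) ^ (δ' - δ)) *
        ‖gradient φ x‖ ^ p)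
      ≥ (∫ x in Kᶜ, (Metric.infDist x K ^ δ * (1 + Metric.infDist x K) ^ (δ' - δ)) *
          |⟪gradient (fun y => Metric.infDist y K) x, gradient φ x⟫| ^ p)
    ∧ (∫ x in Kᶜ, (Metric.infDist x K ^ δ * (1 + Metric.infDist x K) ^ (δ' - δ)) *
          |⟪gradient (fun y => Metric.infDist y K) x, gradient φ x⟫| ^ p)
      ≥ (((d : ℝ) - dH + min δ δ' - p) / p) ^ p *
        (∫ x in Kᶜ, (Metric.infDist x K ^ δ * (1 + Metric.infDist x K) ^ (δ' - δ)) *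
          Metric.infDist x K ^ (-p) * |φ x| ^ p) := by
  obtain ⟨P, h⟩ := HardyAux.exists_isProj hKne hKcl hKconv
  have hp0 : 0 < p := by linarith
  have hKm : MeasurableSet Kᶜ := hKcl.measurableSet.compl
  have hrc : Continuous fun x : EuclideanSpace ℝ (Fin d) => Metric.infDist x K :=
    Metric.continuous_infDist_pt K
  have hr0 : ∀ x : EuclideanSpace ℝ (Fin d), 0 ≤ Metric.infDist x K :=
    fun x => Metric.infDist_nonneg
  have hφ' := hφ.continuous_fderiv (by norm_num)
  have hgn : ∀ x, ‖gradient φ x‖ = ‖fderiv ℝ φ x‖ := fun x => by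
    rw [gradient, LinearIsometryEquiv.norm_map]
  set c : EuclideanSpace ℝ (Fin d) → ℝ :=
    fun x => Metric.infDist x K ^ δ * (1 + Metric.infDist x K) ^ (δ' - δ) with hc
  have hcc : Continuous c := by
    apply Continuous.mul
    · exact hrc.rpow_const fun x => Or.inr hδ
    · exact (continuous_const.add hrc).rpow_const fun x => Or.inl (ne_of_gt (add_pos_of_pos_of_nonneg one_pos (hr0 x)))
  have hc0 : ∀ x, 0 ≤ c x := fun x => by have := hr0 x; simp only [hc]; positivity
  have hI0 : Integrable (fun x => c x * ‖gradient φ x‖ ^ p) (volume.restrict Kᶜ) := by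
    apply Integrable.restrict
    simp_rw [hgn]
    apply Continuous.integrable_of_hasCompactSupport
    · exact hcc.mul (hφ'.norm.rpow_const fun x => Or.inr hp0.le)
    · apply HasCompactSupport.mul_left
      exact (hφc.fderiv ℝ).comp_left (g := fun v => ‖v‖ ^ p) (by simp [hp0.ne'])
  have hgr : ∀ x ∈ Kᶜ, 0 < Metric.infDist x K ∧
      |⟪gradient (fun y => Metric.infDist y K) x, gradient φ x⟫| =
        |fderiv ℝ φ x (x - P x)| / Metric.infDist x K := by
    intro x hx
    have hpos : 0 < ‖x - P x‖ := norm_pos_iff.2 fun h0 => hx (h.eq_self_iff.1 h0)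
    rw [h.infDist]
    refine ⟨hpos, ?_⟩
    rw [(h.hasGradientAt hx).gradient, real_inner_comm, inner_gradient_left, map_smul, smul_eq_mul,
      abs_mul, abs_inv, abs_norm]
    field_simp
  have hle : ∀ x ∈ Kᶜ, |⟪gradient (fun y => Metric.infDist y K) x, gradient φ x⟫| ≤
      ‖gradient φ x‖ := by
    intro x hx
    obtain ⟨h1, h2⟩ := hgr x hx
    rw [h2, div_le_iff₀ h1, h.infDist, hgn]
    exact (fderiv ℝ φ x).le_opNorm _
  have hle' : ∀ᵐ x ∂(volume.restrict Kᶜ),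
      c x * |⟪gradient (fun y => Metric.infDist y K) x, gradient φ x⟫| ^ p ≤
        c x * ‖gradient φ x‖ ^ p := by
    filter_upwards [ae_restrict_mem hKm] with x hx
    have := hle x hx
    have := hc0 x
    gcongr
  have hn1 : ∀ x, 0 ≤ c x * |⟪gradient (fun y => Metric.infDist y K) x, gradient φ x⟫| ^ p :=
    fun x => mul_nonneg (hc0 x) (by positivity)
  refine ⟨integral_mono_of_nonneg (Filter.Eventually.of_forall hn1) hI0 hle', ?_⟩
  have heq1 : ∀ x ∈ Kᶜ, c x * |⟪gradient (fun y => Metric.infDist y K) x, gradient φ x⟫| ^ p =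
      HardyAux.wt δ δ' p (Metric.infDist x K) * |fderiv ℝ φ x (x - P x)| ^ p := by
    intro x hx
    obtain ⟨h1, h2⟩ := hgr x hx
    rw [h2, Real.div_rpow (abs_nonneg _) h1.le, HardyAux.wt, Real.rpow_neg h1.le]
    simp only [hc]
    ring
  have hψc : Continuous fun x => fderiv ℝ φ x (x - P x) := by
    have := h.lip.continuous
    fun_prop
  have hwm : Measurable fun x => HardyAux.wt δ δ' p (Metric.infDist x K) := by
    have := hrc.measurable
    simp only [HardyAux.wt]
    fun_prop
  have hw0 : ∀ x, 0 ≤ HardyAux.wt δ δ' p (Metric.infDist x K) := fun x => by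
    have := hr0 x
    simp only [HardyAux.wt]; positivity
  have hm1 : Measurable fun x =>
      HardyAux.wt δ δ' p (Metric.infDist x K) * |fderiv ℝ φ x (x - P x)| ^ p := by
    have := hψc.measurable
    fun_prop
  have hm2 : Measurable fun x => HardyAux.wt δ δ' p (Metric.infDist x K) * |φ x| ^ p := by
    have := hφ.continuous.measurable
    fun_prop
  have hI1 : Integrable (fun x => HardyAux.wt δ δ' p (Metric.infDist x K) *
      |fderiv ℝ φ x (x - P x)| ^ p) (volume.restrict Kᶜ) := by
    refine hI0.mono' hm1.aestronglyMeasurable ?_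
    filter_upwards [hle', ae_restrict_mem hKm] with x hx hx'
    rw [← heq1 x hx', Real.norm_of_nonneg (hn1 x)]
    exact hx
  have hE : ∀ x (b : ℝ), ENNReal.ofReal (HardyAux.wt δ δ' p (Metric.infDist x K) * |b| ^ p) =
      ENNReal.ofReal (HardyAux.wt δ δ' p (Metric.infDist x K)) * ‖b‖ₑ ^ p := by
    intro x b
    rw [ENNReal.ofReal_mul (hw0 x), ← ENNReal.ofReal_rpow_of_nonneg (abs_nonneg _) hp0.le,
      Real.enorm_eq_ofReal_abs]
  have main := HardyAux.main_lintegral h hKcl hd hdH hp hcond hφ hφc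
  simp_rw [← hE] at main
  rw [setIntegral_congr_fun hKm heq1]
  change _ * (∫ x in Kᶜ, HardyAux.wt δ δ' p (Metric.infDist x K) * |φ x| ^ p) ≤ _
  rw [integral_eq_lintegral_of_nonneg_ae
      (Filter.Eventually.of_forall fun x => mul_nonneg (hw0 x) (by positivity))
      hm2.aestronglyMeasurable,
    integral_eq_lintegral_of_nonneg_ae
      (Filter.Eventually.of_forall fun x => mul_nonneg (hw0 x) (by positivity))
      hm1.aestronglyMeasurable]
  have hfin := hI1.lintegral_lt_top
  set a := ((d : ℝ) - dH + min δ δ' - p) / p with ha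
  have ha0 : 0 < a := by positivity
  have main' := ENNReal.toReal_mono (ENNReal.mul_ne_top (by finiteness) hfin.ne) main
  rw [ENNReal.toReal_mul, ← ENNReal.toReal_rpow, ENNReal.toReal_ofReal (by positivity),
    Real.inv_rpow ha0.le] at main'
  have hap : 0 < a ^ p := by positivity
  rwa [inv_mul_eq_div, le_div_iff₀ hap, mul_comm] at main'
end
end

section
/- Let p ∈ (1,∞) and δ, δ' ∈ [0,2) satisfy (d − d_H + p·min(δ,δ') − 2p)(2 − max(δ,δ')) > 2p|δ − δ'|, and set C_p = (p−1)(d−d_H)(d−d_H+p·min(δ,δ')−2p)/p². Then there exists a constant c_p with 0 < c_p ≤ C_p such that ∫_Ω |Hφ|^p ≥ c_p^p ∫_Ω (c_Ω d_Γ^{−2})^p |φ|^p for all φ ∈ C_c^2(Ω). -/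
open MeasureTheory Set
open scoped RealInnerProductSpace

noncomputable section

/-- The weight `c_Ω = c ∘ d_Γ` with `c(s) = s^δ (1+s)^(δ'-δ)`. -/
def cWeight {d : ℕ} (K : Set (EuclideanSpace ℝ (Fin d))) (δ δ' : ℝ)
    (x : EuclideanSpace ℝ (Fin d)) : ℝ :=
  Metric.infDist x K ^ δ * (1 + Metric.infDist x K) ^ (δ' - δ)

/-- The Laplacian `Δφ = Σ_k ∂_k² φ`. -/
def lapl {d : ℕ} (φ : EuclideanSpace ℝ (Fin d) → ℝ) (x : EuclideanSpace ℝ (Fin d)) : ℝ :=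
  ∑ i, iteratedFDeriv ℝ 2 φ x (fun _ => EuclideanSpace.single i (1 : ℝ))

/-- The weighted operator `H = -div(c_Ω ∇)`, i.e.
`(Hφ)(x) = -c_Ω(x) Δφ(x) - ∇c_Ω(x)·∇φ(x)`. -/
def Hop {d : ℕ} (K : Set (EuclideanSpace ℝ (Fin d))) (δ δ' : ℝ)
    (φ : EuclideanSpace ℝ (Fin d) → ℝ) (x : EuclideanSpace ℝ (Fin d)) : ℝ :=
  -(cWeight K δ δ' x) * lapl φ x - ⟪gradient (cWeight K δ δ') x, gradient φ x⟫


section RellichAux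
open Filter Topology

/-- abbreviation for the space -/
abbrev RE (d : ℕ) := EuclideanSpace ℝ (Fin d)

lemma rel_exists_proj {d : ℕ} (K : Set (RE d)) (hKne : K.Nonempty) (hKcl : IsClosed K)
    (hKconv : Convex ℝ K) : ∃ N : RE d → RE d, (∀ x, x - N x ∈ K) ∧
      (∀ x, ‖N x‖ = Metric.infDist x K) ∧ ∀ x, ∀ y ∈ K, ⟪N x, y - (x - N x)⟫ ≤ 0 := by
  have h : ∀ x : RE d, ∃ n : RE d, x - n ∈ K ∧ ‖n‖ = Metric.infDist x K ∧
      ∀ y ∈ K, ⟪n, y - (x - n)⟫ ≤ 0 := by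
    intro x
    obtain ⟨v, hv, hvn⟩ := exists_norm_eq_iInf_of_complete_convex hKne hKcl.isComplete hKconv x
    refine ⟨x - v, by simpa using hv, ?_, ?_⟩
    · rw [hvn, Metric.infDist_eq_iInf]
      simp [dist_eq_norm]
    · have := (norm_eq_iInf_iff_real_inner_le_zero hKconv hv).1 hvn
      simpa using this
  choose N h1 h2 h3 using h
  exact ⟨N, h1, h2, h3⟩

lemma rel_N_lip {d : ℕ} (K : Set (RE d)) (N : RE d → RE d) (h1 : ∀ x, x - N x ∈ K)
    (h3 : ∀ x, ∀ y ∈ K, ⟪N x, y - (x - N x)⟫ ≤ 0) (x y : RE d) :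
    ‖N x - N y‖ ≤ ‖x - y‖ := by
  have a := h3 x _ (h1 y)
  have b := h3 y _ (h1 x)
  have c : ‖N x - N y‖ ^ 2 ≤ ⟪N x - N y, x - y⟫ := by
    rw [← real_inner_self_eq_norm_sq]
    simp only [inner_sub_left, inner_sub_right] at *
    linarith
  have e := real_inner_le_norm (N x - N y) (x - y)
  by_contra hh
  push Not at hh
  have := norm_nonneg (x - y)
  nlinarith

/-- half squared distance -/
def rq {d : ℕ} (K : Set (RE d)) (x : RE d) : ℝ := Metric.infDist x K ^ 2 / 2

lemma rel_rq_hasFDerivAt {d : ℕ} (K : Set (RE d)) (N : RE d → RE d) (h1 : ∀ x, x - N x ∈ K)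
    (h2 : ∀ x, ‖N x‖ = Metric.infDist x K)
    (h3 : ∀ x, ∀ y ∈ K, ⟪N x, y - (x - N x)⟫ ≤ 0) (x : RE d) :
    HasFDerivAt (rq K) (innerSL ℝ (N x)) x := by
  have key : ∀ y z : RE d, rq K y ≤ ‖y - (z - N z)‖ ^ 2 / 2 := by
    intro y z
    have : Metric.infDist y K ≤ ‖y - (z - N z)‖ := by
      rw [← dist_eq_norm]; exact Metric.infDist_le_dist_of_mem (h1 z)
    unfold rq
    have h0 : 0 ≤ Metric.infDist y K := Metric.infDist_nonneg
    gcongr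
  have up : ∀ y z : RE d, rq K y ≤ rq K z + ⟪N z, y - z⟫ + ‖y - z‖ ^ 2 / 2 := by
    intro y z
    refine (key y z).trans_eq ?_
    have : y - (z - N z) = N z + (y - z) := by abel
    rw [this, norm_add_sq_real, rq, ← h2]
    ring
  have hO : (fun y => rq K y - rq K x - innerSL ℝ (N x) (y - x)) =O[𝓝 x] fun y => ‖y - x‖ ^ 2 := by
    refine Asymptotics.IsBigO.of_bound 2 (Eventually.of_forall fun y => ?_)
    have u1 := up y x
    have u2 := up x y
    have l := rel_N_lip K N h1 h3 y x
    have c := real_inner_le_norm (N x - N y) (y - x)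
    have e : ⟪N y, x - y⟫ = - ⟪N y, y - x⟫ := by rw [← inner_neg_right]; simp
    rw [norm_sub_rev x y] at u2
    rw [norm_sub_rev (N x) (N y), inner_sub_left] at c
    rw [Real.norm_eq_abs, Real.norm_eq_abs, abs_of_nonneg (sq_nonneg ‖y - x‖), innerSL_apply_apply, abs_le]
    have n0 := norm_nonneg (y - x)
    have : ‖N y - N x‖ * ‖y - x‖ ≤ ‖y - x‖ ^ 2 := by rw [sq]; gcongr
    constructor <;> nlinarith
  have h0 := hO.hasFDerivAt (𝕜 := ℝ) (by norm_num)
  have h4 : HasFDerivAt (fun y => innerSL ℝ (N x) (y - x)) (innerSL ℝ (N x)) x := by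
    have := (innerSL ℝ (N x)).hasFDerivAt.comp x ((hasFDerivAt_id x).sub_const x)
    rw [ContinuousLinearMap.comp_id] at this
    exact this
  have h5 := (h0.add h4).add_const (rq K x)
  simp only [zero_add] at h5
  refine h5.congr_of_eventuallyEq (Eventually.of_forall fun y => ?_)
  simp

lemma rel_rq_contDiff {d : ℕ} (K : Set (RE d)) (N : RE d → RE d) (h1 : ∀ x, x - N x ∈ K)
    (h2 : ∀ x, ‖N x‖ = Metric.infDist x K)
    (h3 : ∀ x, ∀ y ∈ K, ⟪N x, y - (x - N x)⟫ ≤ 0) : ContDiff ℝ 1 (rq K) := by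
  rw [contDiff_one_iff_fderiv]
  refine ⟨fun x => (rel_rq_hasFDerivAt K N h1 h2 h3 x).differentiableAt, ?_⟩
  have : fderiv ℝ (rq K) = fun x => innerSL ℝ (N x) :=
    funext fun x => (rel_rq_hasFDerivAt K N h1 h2 h3 x).fderiv
  rw [this]
  refine (innerSL ℝ).continuous.comp ?_
  have : LipschitzWith 1 N := LipschitzWith.of_dist_le_mul fun x y => by
    simpa [dist_eq_norm] using rel_N_lip K N h1 h3 x y
  exact this.continuous

lemma rel_pos {d : ℕ} {K : Set (RE d)} (hKne : K.Nonempty) (hKcl : IsClosed K) {x : RE d}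
    (hx : x ∈ Kᶜ) : 0 < Metric.infDist x K := by
  exact (hKcl.notMem_iff_infDist_pos hKne).1 hx

lemma rel_dist_contDiffAt {d : ℕ} (K : Set (RE d)) (hKne : K.Nonempty) (hKcl : IsClosed K)
    (hKconv : Convex ℝ K) {x : RE d} (hx : x ∈ Kᶜ) :
    ContDiffAt ℝ 1 (fun y => Metric.infDist y K) x := by
  obtain ⟨N, h1, h2, h3⟩ := rel_exists_proj K hKne hKcl hKconv
  have hq := (rel_rq_contDiff K N h1 h2 h3).contDiffAt (x := x)
  have hpos := rel_pos hKne hKcl hx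
  have h4 : ContDiffAt ℝ 1 (fun y => √(2 * rq K y)) x := by
    refine ContDiffAt.sqrt (contDiffAt_const.mul hq) ?_
    unfold rq; positivity
  refine h4.congr_of_eventuallyEq (Eventually.of_forall fun y => ?_)
  have : 2 * rq K y = Metric.infDist y K ^ 2 := by unfold rq; ring
  simp only [this]
  rw [Real.sqrt_sq Metric.infDist_nonneg]

lemma rel_rq_fderiv {d : ℕ} (K : Set (RE d)) (hKne : K.Nonempty) (hKcl : IsClosed K)
    (hKconv : Convex ℝ K) {x : RE d} (hx : x ∈ Kᶜ) (v : RE d) :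
    fderiv ℝ (rq K) x v = Metric.infDist x K * fderiv ℝ (fun y => Metric.infDist y K) x v := by
  have h := ((rel_dist_contDiffAt K hKne hKcl hKconv hx).differentiableAt (by norm_num)).hasFDerivAt
  have h' := (h.pow 2).mul_const (2⁻¹ : ℝ)
  have : rq K = fun y => Metric.infDist y K ^ 2 * 2⁻¹ := by
    ext y; rw [rq]; ring
  rw [this, h'.fderiv]
  simp
  ring

lemma rel_grad_sq {d : ℕ} (K : Set (RE d)) (hKne : K.Nonempty) (hKcl : IsClosed K)
    (hKconv : Convex ℝ K) {x : RE d} (hx : x ∈ Kᶜ) :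
    ∑ i : Fin d, fderiv ℝ (fun y => Metric.infDist y K) x (EuclideanSpace.single i 1) ^ 2 = 1 := by
  obtain ⟨N, h1, h2, h3⟩ := rel_exists_proj K hKne hKcl hKconv
  have hpos := rel_pos hKne hKcl hx
  have h5 : ∀ i : Fin d, Metric.infDist x K *
      fderiv ℝ (fun y => Metric.infDist y K) x (EuclideanSpace.single i 1) = N x i := by
    intro i
    rw [← rel_rq_fderiv K hKne hKcl hKconv hx, (rel_rq_hasFDerivAt K N h1 h2 h3 x).fderiv]
    simp [EuclideanSpace.inner_single_right]
  have h6 : ∑ i, (N x i) ^ 2 = Metric.infDist x K ^ 2 := by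
    rw [← h2, EuclideanSpace.norm_sq_eq]; simp
  simp only [← h5, mul_pow, ← Finset.mul_sum] at h6
  have : Metric.infDist x K ^ 2 ≠ 0 := by positivity
  exact mul_left_cancel₀ this (by linarith)

lemma rel_mid {d : ℕ} (K : Set (RE d)) (N : RE d → RE d) (h1 : ∀ x, x - N x ∈ K)
    (hKconv : Convex ℝ K) (x v : RE d) :
    Metric.infDist x K ≤ ‖(1/2 : ℝ) • (N (x + v) + N (x - v))‖ := by
  have hm := hKconv (h1 (x + v)) (h1 (x - v)) (a := 1/2) (b := 1/2) (by norm_num) (by norm_num)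
    (by norm_num)
  have := Metric.infDist_le_dist_of_mem (x := x) hm
  rw [dist_eq_norm] at this
  have e : x - ((1 / 2 : ℝ) • (x + v - N (x + v)) + (1 / 2 : ℝ) • (x - v - N (x - v)))
      = (1/2 : ℝ) • (N (x + v) + N (x - v)) := by module
  rwa [e] at this

lemma rel_sd_dist {d : ℕ} (K : Set (RE d)) (hKne : K.Nonempty) (hKcl : IsClosed K)
    (hKconv : Convex ℝ K) (x v : RE d) :
    0 ≤ Metric.infDist (x + v) K + Metric.infDist (x - v) K - 2 * Metric.infDist x K := by
  obtain ⟨N, h1, h2, h3⟩ := rel_exists_proj K hKne hKcl hKconv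
  have h := rel_mid K N h1 hKconv x v
  rw [norm_smul] at h
  have := norm_add_le (N (x + v)) (N (x - v))
  rw [h2, h2] at this
  norm_num at h
  linarith

lemma rel_sd_rq {d : ℕ} (K : Set (RE d)) (hKne : K.Nonempty) (hKcl : IsClosed K)
    (hKconv : Convex ℝ K) (x v : RE d) :
    ‖(affineSpan ℝ K).directionᗮ.starProjection v‖ ^ 2 ≤
      rq K (x + v) + rq K (x - v) - 2 * rq K x := by
  obtain ⟨N, h1, h2, h3⟩ := rel_exists_proj K hKne hKcl hKconv
  have h := rel_mid K N h1 hKconv x v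
  set V := (affineSpan ℝ K).direction with hV
  have hmem : (x + v - N (x + v)) - (x - v - N (x - v)) ∈ V :=
    AffineSubspace.vsub_mem_direction (subset_affineSpan ℝ K (h1 _)) (subset_affineSpan ℝ K (h1 _))
  have hz : Vᗮ.starProjection ((1/2 : ℝ) • ((x + v - N (x + v)) - (x - v - N (x - v)))) = 0 := by
    rw [map_smul, (Submodule.starProjection_apply_eq_zero_iff (K := Vᗮ)).2
      (by rw [Submodule.orthogonal_orthogonal]; exact hmem), smul_zero]
  have hv : Vᗮ.starProjection v = Vᗮ.starProjection ((1/2 : ℝ) • (N (x + v) - N (x - v))) := by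
    rw [← sub_eq_zero, ← map_sub, ← hz]
    congr 1
    module
  have hle : ‖Vᗮ.starProjection v‖ ≤ ‖(1/2 : ℝ) • (N (x + v) - N (x - v))‖ := by
    rw [hv]; exact Submodule.norm_starProjection_apply_le _ _
  have pl := parallelogram_law_with_norm ℝ (N (x + v)) (N (x - v))
  rw [norm_smul, Real.norm_of_nonneg (by norm_num)] at h hle
  have h7 : ‖Vᗮ.starProjection v‖ ^ 2 ≤ (1/2 * ‖N (x + v) - N (x - v)‖) ^ 2 := by gcongr
  have h8 : Metric.infDist x K ^ 2 ≤ (1/2 * ‖N (x + v) + N (x - v)‖) ^ 2 := by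
    have h0 : 0 ≤ Metric.infDist x K := Metric.infDist_nonneg
    gcongr
  unfold rq
  rw [← h2 (x + v), ← h2 (x - v)]
  nlinarith

lemma rel_trace {d : ℕ} (V : Submodule ℝ (RE d)) :
    ∑ i : Fin d, ‖Vᗮ.starProjection (EuclideanSpace.single i 1)‖ ^ 2
      = (d : ℝ) - Module.finrank ℝ V := by
  have hp : LinearMap.IsProj Vᗮ (Vᗮ.starProjection : RE d →ₗ[ℝ] RE d) :=
    ⟨fun x => by simp, fun x hx => by
      simpa using (Submodule.starProjection_eq_self_iff (K := Vᗮ)).2 hx⟩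
  have h1 := hp.trace
  rw [LinearMap.trace_eq_sum_inner _ (EuclideanSpace.basisFun (Fin d) ℝ)] at h1
  have h2 := Submodule.finrank_add_finrank_orthogonal V
  rw [finrank_euclideanSpace_fin] at h2
  have h3 : (Module.finrank ℝ V : ℝ) + Module.finrank ℝ Vᗮ = d := by exact_mod_cast h2
  rw [eq_sub_iff_add_eq', ← h3, ← h1]
  congr 1
  refine Finset.sum_congr rfl fun i _ => ?_
  rw [EuclideanSpace.basisFun_apply]
  rw [ContinuousLinearMap.coe_coe, ← real_inner_self_eq_norm_sq,
    Submodule.inner_starProjection_left_eq_right,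
    (Submodule.starProjection_eq_self_iff (K := Vᗮ)).2 (by simp)]

lemma rel_integrable {d : ℕ} {S : Set (RE d)} (hS : IsCompact S) {f : RE d → ℝ}
    (hf : ContinuousOn f S) (h0 : ∀ x, x ∉ S → f x = 0) : Integrable f := by
  rw [← integrableOn_iff_integrable_of_support_subset (s := S)]
  · exact hf.integrableOn_compact hS
  · intro x hx
    by_contra h
    exact hx (h0 x h)

lemma rel_eventually_zero {d : ℕ} {S : Set (RE d)} (hS : IsClosed S) {f : RE d → ℝ}
    (h0 : ∀ x, x ∉ S → f x = 0) {x : RE d} (hx : x ∉ S) : f =ᶠ[𝓝 x] fun _ => 0 := by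
  filter_upwards [hS.isOpen_compl.mem_nhds hx] with y hy using h0 y hy

lemma rel_contDiff {d : ℕ} {S : Set (RE d)} (hS : IsClosed S) {f : RE d → ℝ}
    (hf : ∀ x ∈ S, ContDiffAt ℝ 1 f x) (h0 : ∀ x, x ∉ S → f x = 0) : ContDiff ℝ 1 f := by
  rw [contDiff_iff_contDiffAt]
  intro x
  by_cases hx : x ∈ S
  · exact hf x hx
  · exact contDiffAt_const.congr_of_eventuallyEq (rel_eventually_zero hS h0 hx)

lemma rel_fderiv_zero {d : ℕ} {S : Set (RE d)} (hS : IsClosed S) {f : RE d → ℝ}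
    (h0 : ∀ x, x ∉ S → f x = 0) {x : RE d} (hx : x ∉ S) : fderiv ℝ f x = 0 := by
  rw [(rel_eventually_zero hS h0 hx).fderiv_eq]
  simp

lemma rel_hcs {d : ℕ} {S : Set (RE d)} (hS : IsCompact S) {f : RE d → ℝ}
    (h0 : ∀ x, x ∉ S → f x = 0) : HasCompactSupport f :=
  HasCompactSupport.intro hS h0

lemma rel_key1 {d : ℕ} {S : Set (RE d)} (hS : IsCompact S) {f u : RE d → ℝ} (e : RE d)
    (he : ‖e‖ = 1) (a : ℝ)
    (hfc : Continuous f)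
    (hfl : ∀ R : ℝ, ∃ L : ℝ, ∀ x y, ‖x‖ ≤ R → ‖y‖ ≤ R → |f x - f y| ≤ L * ‖x - y‖)
    (hsd : ∀ x, ∀ h : ℝ, a * h ^ 2 ≤ f (x + h • e) + f (x - h • e) - 2 * f x)
    (hfd : ∀ x ∈ S, DifferentiableAt ℝ f x)
    (hu : ContDiff ℝ 1 u) (hu0 : ∀ x, x ∉ S → u x = 0) (hun : ∀ x, 0 ≤ u x) :
    a * ∫ x, u x ≤ - ∫ x, fderiv ℝ f x e * fderiv ℝ u x e := by
  have hcs : HasCompactSupport u := rel_hcs hS hu0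
  have huc : Continuous u := hu.continuous
  -- discrete inequality
  have disc : ∀ h : ℝ, a * h ^ 2 * ∫ x, u x ≤
      ∫ x, (f (x + h • e) - f x) * (u x - u (x + h • e)) := by
    intro h
    have hcs' : HasCompactSupport (fun x => u (x + h • e)) :=
      hcs.comp_homeomorph (Homeomorph.addRight (h • e))
    have i1 : Integrable (fun x => f (x + h • e) * u x) :=
      Continuous.integrable_of_hasCompactSupport (by fun_prop) (hcs.mul_left)
    have i2 : Integrable (fun x => f x * u x) :=
      Continuous.integrable_of_hasCompactSupport (by fun_prop) (hcs.mul_left)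
    have i3 : Integrable (fun x => f (x + h • e) * u (x + h • e)) :=
      Continuous.integrable_of_hasCompactSupport (by fun_prop) (hcs'.mul_left)
    have i4 : Integrable (fun x => f x * u (x + h • e)) :=
      Continuous.integrable_of_hasCompactSupport (by fun_prop) (hcs'.mul_left)
    have i5 : Integrable (fun x => f (x - h • e) * u x) :=
      Continuous.integrable_of_hasCompactSupport (by fun_prop) (hcs.mul_left)
    have iu : Integrable u := huc.integrable_of_hasCompactSupport hcs
    have e3 : ∫ x, f (x + h • e) * u (x + h • e) = ∫ x, f x * u x :=
      integral_add_right_eq_self (fun x => f x * u x) (h • e)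
    have e4 : ∫ x, f x * u (x + h • e) = ∫ x, f (x - h • e) * u x := by
      rw [← integral_add_right_eq_self (fun x => f (x - h • e) * u x) (h • e)]
      simp
    have e0 : ∫ x, (f (x + h • e) - f x) * (u x - u (x + h • e)) =
        ∫ x, (f (x + h • e) + f (x - h • e) - 2 * f x) * u x := by
      have l : ∫ x, (f (x + h • e) - f x) * (u x - u (x + h • e)) =
          ((∫ x, f (x + h • e) * u x) - ∫ x, f x * u x) - (∫ x, f (x + h • e) * u (x + h • e))
           + ∫ x, f x * u (x + h • e) := by
        have i12 : Integrable (fun x => f (x + h • e) * u x - f x * u x) := i1.sub i2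
        have i123 : Integrable (fun x => f (x + h • e) * u x - f x * u x
          - f (x + h • e) * u (x + h • e)) := i12.sub i3
        rw [← integral_sub i1 i2, ← integral_sub i12 i3, ← integral_add i123 i4]
        congr 1; ext x; ring
      have r : ∫ x, (f (x + h • e) + f (x - h • e) - 2 * f x) * u x =
          ((∫ x, f (x + h • e) * u x) + ∫ x, f (x - h • e) * u x) - 2 * (∫ x, f x * u x) := by
        have i15 : Integrable (fun x => f (x + h • e) * u x + f (x - h • e) * u x) := i1.add i5
        rw [← integral_const_mul, ← integral_add i1 i5, ← integral_sub i15 (i2.const_mul 2)]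
        congr 1; ext x; ring
      rw [l, r, e3, e4]; ring
    rw [e0, ← integral_const_mul]
    refine integral_mono (iu.const_mul _) ?_ fun x => ?_
    · have := (i1.add i5).sub (i2.const_mul 2)
      refine this.congr (Eventually.of_forall fun x => ?_)
      simp only [Pi.add_apply, Pi.sub_apply]; ring
    · exact mul_le_mul_of_nonneg_right (hsd x h) (hun x)
  -- limit
  obtain ⟨Lu, hLu⟩ := ContDiff.lipschitzWith_of_hasCompactSupport hcs hu (by norm_num)
  obtain ⟨R, hR⟩ := hS.isBounded.exists_norm_le
  obtain ⟨L, hL⟩ := hfl (R + 2)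
  set hn : ℕ → ℝ := fun n => 1 / ((n : ℝ) + 1) with hhn
  have hn0 : ∀ n, 0 < hn n := fun n => by positivity
  have hn1 : ∀ n, hn n ≤ 1 := fun n => by
    rw [hhn]; simp only; rw [div_le_one (by positivity)]; linarith [n.cast_nonneg (α := ℝ)]
  have hnt : Tendsto hn atTop (𝓝[≠] 0) := by
    refine tendsto_nhdsWithin_iff.2 ⟨tendsto_one_div_add_atTop_nhds_zero_nat, ?_⟩
    exact Eventually.of_forall fun n => (hn0 n).ne'
  set Fn : ℕ → RE d → ℝ := fun n x =>
    ((hn n)⁻¹ * (f (x + hn n • e) - f x)) * (-((hn n)⁻¹ * (u (x + hn n • e) - u x))) with hFn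
  have lim : Tendsto (fun n => ∫ x, Fn n x) atTop
      (𝓝 (∫ x, -(fderiv ℝ f x e * fderiv ℝ u x e))) := by
    refine tendsto_integral_of_dominated_convergence
      ((Metric.closedBall (0 : RE d) (R + 1)).indicator fun _ => L * Lu) ?_ ?_ ?_ ?_
    · intro n
      refine Continuous.aestronglyMeasurable ?_
      simp only [hFn]; fun_prop
    · rw [integrable_indicator_iff Metric.isClosed_closedBall.measurableSet]
      exact continuousOn_const.integrableOn_compact (isCompact_closedBall _ _)
    · intro n
      refine Eventually.of_forall fun x => ?_
      have hne : ‖hn n • e‖ = hn n := by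
        rw [norm_smul, he, mul_one, Real.norm_of_nonneg (hn0 n).le]
      by_cases hx : x ∈ Metric.closedBall (0 : RE d) (R + 1)
      · rw [indicator_of_mem hx]
        rw [mem_closedBall_zero_iff] at hx
        have b1 := hL (x + hn n • e) x
          (by have := norm_add_le x (hn n • e); have := hn1 n; linarith) (by linarith)
        have b2 := hLu.dist_le_mul (x + hn n • e) x
        rw [dist_eq_norm, dist_eq_norm, Real.norm_eq_abs] at b2
        rw [add_sub_cancel_left, hne] at b1 b2
        have hh := hn0 n
        simp only [hFn, norm_mul, norm_neg, norm_inv, Real.norm_eq_abs, abs_of_pos hh]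
        have c1 : (hn n)⁻¹ * |f (x + hn n • e) - f x| ≤ L := by
          rw [inv_mul_le_iff₀ hh]; linarith
        have c2 : (hn n)⁻¹ * |u (x + hn n • e) - u x| ≤ Lu := by
          rw [inv_mul_le_iff₀ hh]; linarith
        have : 0 ≤ (hn n)⁻¹ * |f (x + hn n • e) - f x| := by positivity
        have : 0 ≤ L := this.trans c1
        gcongr
      · rw [indicator_of_notMem hx]
        rw [mem_closedBall_zero_iff, not_le] at hx
        have z1 : u x = 0 := hu0 x fun h => by have := hR x h; linarith
        have z2 : u (x + hn n • e) = 0 := hu0 _ fun h => by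
          have := hR _ h
          have h2 := norm_sub_le (x + hn n • e) (hn n • e)
          rw [add_sub_cancel_right] at h2
          have := hn1 n
          linarith
        simp [hFn, z1, z2]
    · refine Eventually.of_forall fun x => ?_
      have tu := (((hu.differentiable (by norm_num)).differentiableAt (x := x)).hasFDerivAt.hasLineDerivAt
        e).tendsto_slope_zero.comp hnt
      by_cases hx : x ∈ S
      · have tf := ((hfd x hx).hasFDerivAt.hasLineDerivAt e).tendsto_slope_zero.comp hnt
        have := tf.mul tu.neg
        simpa [hFn, Function.comp_def] using this
      · rw [rel_fderiv_zero hS.isClosed hu0 hx]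
        simp only [zero_apply, mul_zero, neg_zero]
        refine tendsto_const_nhds.congr' ?_
        have ev := rel_eventually_zero hS.isClosed hu0 hx
        have tx : Tendsto (fun n => x + hn n • e) atTop (𝓝 x) := by
          have : Tendsto (fun n => x + hn n • e) atTop (𝓝 (x + (0:ℝ) • e)) :=
            tendsto_const_nhds.add ((tendsto_nhdsWithin_iff.1 hnt).1.smul_const e)
          simpa using this
        filter_upwards [tx.eventually ev] with n h
        simp [hFn, h, hu0 x hx]
  rw [integral_neg] at lim
  refine ge_of_tendsto' lim fun n => ?_
  have hd := disc (hn n)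
  have hh := hn0 n
  have : ∫ x, Fn n x = ((hn n)⁻¹ ^ 2) * ∫ x, (f (x + hn n • e) - f x) * (u x - u (x + hn n • e)) := by
    rw [← integral_const_mul]
    congr 1; ext x; simp only [hFn]; ring
  rw [this, inv_pow, ← div_eq_inv_mul, le_div_iff₀ (by positivity)]
  linarith

lemma rel_lip_fderiv_cont {d : ℕ} {S : Set (RE d)} {f : RE d → ℝ}
    (hfd : ∀ x ∈ S, ContDiffAt ℝ 1 f x) (v : RE d) :
    ContinuousOn (fun x => fderiv ℝ f x v) S := by
  intro x hx
  have h : ContinuousAt (fderiv ℝ f) x :=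
    ((hfd x hx).fderiv_right (m := 0) (by norm_num)).continuousAt
  exact (h.clm_apply continuousAt_const).continuousWithinAt

/-- dot product of gradients -/
def rB {d : ℕ} (f g : RE d → ℝ) (x : RE d) : ℝ :=
  ∑ i : Fin d, fderiv ℝ f x (EuclideanSpace.single i 1) * fderiv ℝ g x (EuclideanSpace.single i 1)

lemma rel_key2 {d : ℕ} {S : Set (RE d)} (hS : IsCompact S) {f u : RE d → ℝ}
    (a : Fin d → ℝ)
    (hfc : Continuous f)
    (hfl : ∀ R : ℝ, ∃ L : ℝ, ∀ x y, ‖x‖ ≤ R → ‖y‖ ≤ R → |f x - f y| ≤ L * ‖x - y‖)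
    (hsd : ∀ i x, ∀ h : ℝ, a i * h ^ 2 ≤ f (x + h • EuclideanSpace.single i 1) +
      f (x - h • EuclideanSpace.single i 1) - 2 * f x)
    (hfd : ∀ x ∈ S, ContDiffAt ℝ 1 f x)
    (hu : ContDiff ℝ 1 u) (hu0 : ∀ x, x ∉ S → u x = 0) (hun : ∀ x, 0 ≤ u x) :
    (∑ i, a i) * ∫ x, u x ≤ - ∫ x, rB f u x := by
  unfold rB
  rw [integral_finsetSum]
  · rw [Finset.sum_mul, ← Finset.sum_neg_distrib]
    refine Finset.sum_le_sum fun i _ => ?_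
    exact rel_key1 hS _ (by simp) (a i) hfc hfl (hsd i)
      (fun x hx => (hfd x hx).differentiableAt (by norm_num)) hu hu0 hun
  · intro i _
    refine rel_integrable hS ?_ ?_
    · exact (rel_lip_fderiv_cont hfd _).mul
        (rel_lip_fderiv_cont (fun x _ => hu.contDiffAt) _)
    · intro x hx
      rw [rel_fderiv_zero hS.isClosed hu0 hx]; simp

/-- weak form of `r Δ r ≥ D - 1` -/
lemma rel_key3 {d : ℕ} (hd : 1 ≤ d) (K : Set (RE d))
    (hKne : K.Nonempty) (hKcl : IsClosed K) (hKconv : Convex ℝ K)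
    (dH : ℕ) (hdH : dH = min (Module.finrank ℝ (affineSpan ℝ K).direction) (d - 1))
    {S : Set (RE d)} (hS : IsCompact S) (hSK : S ⊆ Kᶜ) {v : RE d → ℝ}
    (hv : ContDiff ℝ 1 v) (hv0 : ∀ x, x ∉ S → v x = 0) (hvn : ∀ x, 0 ≤ v x) :
    ((d : ℝ) - dH - 1) * ∫ x, v x / Metric.infDist x K ≤
      - ∫ x, rB (fun y => Metric.infDist y K) v x := by
  have hlip : ∀ x y : RE d, |Metric.infDist x K - Metric.infDist y K| ≤ ‖x - y‖ := by
    intro x y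
    have := (Metric.lipschitz_infDist_pt K).dist_le_mul x y
    simpa [dist_eq_norm, Real.norm_eq_abs] using this
  have hρc : Continuous (fun y => Metric.infDist y K) := Metric.continuous_infDist_pt K
  have hρd : ∀ x ∈ S, ContDiffAt ℝ 1 (fun y => Metric.infDist y K) x := fun x hx =>
    rel_dist_contDiffAt K hKne hKcl hKconv (hSK hx)
  have hfin : Module.finrank ℝ (affineSpan ℝ K).direction ≤ d := by
    simpa using Submodule.finrank_le (affineSpan ℝ K).direction
  rcases le_or_gt d (Module.finrank ℝ (affineSpan ℝ K).direction) with hc | hc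
  · have h1 : dH = d - 1 := by omega
    have h2 : (d : ℝ) - dH - 1 = 0 := by rw [h1]; push_cast [hd]; ring
    rw [h2, zero_mul]
    have := rel_key2 hS (f := fun y => Metric.infDist y K) (u := v) (fun _ => 0) hρc
      (fun R => ⟨1, fun x y _ _ => by simpa using hlip x y⟩)
      (fun i x h => by
        simpa using rel_sd_dist K hKne hKcl hKconv x (h • EuclideanSpace.single i 1))
      hρd hv hv0 hvn
    simpa using this
  · have h1 : dH = Module.finrank ℝ (affineSpan ℝ K).direction := by omega
    have hu : ContDiff ℝ 1 (fun x => v x / Metric.infDist x K) := by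
      refine rel_contDiff hS.isClosed (fun x hx => ?_) (fun x hx => by simp [hv0 x hx])
      exact hv.contDiffAt.div (hρd x hx) (rel_pos hKne hKcl (hSK hx)).ne'
    have hu0 : ∀ x, x ∉ S → v x / Metric.infDist x K = 0 := fun x hx => by simp [hv0 x hx]
    obtain ⟨N, n1, n2, n3⟩ := rel_exists_proj K hKne hKcl hKconv
    have hq := rel_rq_contDiff K N n1 n2 n3
    have key := rel_key2 hS (f := rq K) (u := fun x => v x / Metric.infDist x K)
      (fun i => ‖(affineSpan ℝ K).directionᗮ.starProjection (EuclideanSpace.single i 1)‖ ^ 2)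
      hq.continuous (by
        intro R
        obtain ⟨C, hC⟩ := ((isCompact_closedBall (0 : RE d) R).image hρc).isBounded.exists_norm_le
        refine ⟨C, fun x y hx hy => ?_⟩
        have cx := hC _ (mem_image_of_mem _ (mem_closedBall_zero_iff.2 hx))
        have cy := hC _ (mem_image_of_mem _ (mem_closedBall_zero_iff.2 hy))
        rw [Real.norm_of_nonneg Metric.infDist_nonneg] at cx cy
        have e : rq K x - rq K y = (Metric.infDist x K + Metric.infDist y K) / 2 *
          (Metric.infDist x K - Metric.infDist y K) := by unfold rq; ring
        have p1 : 0 ≤ Metric.infDist x K := Metric.infDist_nonneg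
        have p2 : 0 ≤ Metric.infDist y K := Metric.infDist_nonneg
        rw [e, abs_mul, abs_of_nonneg (by positivity)]
        have := hlip x y
        have : 0 ≤ C := p1.trans cx
        gcongr
        linarith)
      (fun i x h => by
        have := rel_sd_rq K hKne hKcl hKconv x (h • EuclideanSpace.single i 1)
        rw [map_smul, norm_smul, mul_pow, Real.norm_eq_abs, sq_abs] at this
        linarith)
      (fun x _ => hq.contDiffAt) hu hu0 (fun x => div_nonneg (hvn x) Metric.infDist_nonneg)
    rw [rel_trace, ← h1] at key
    have hpt : ∀ x, rB (fun y => Metric.infDist y K) v x =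
        rB (rq K) (fun x => v x / Metric.infDist x K) x + v x / Metric.infDist x K := by
      intro x
      by_cases hx : x ∈ S
      · have hpos := rel_pos hKne hKcl (hSK hx)
        have hg := rel_grad_sq K hKne hKcl hKconv (hSK hx)
        have dρ := ((hρd x hx).differentiableAt (by norm_num)).hasFDerivAt
        have dv := (hv.differentiable (by norm_num) x).hasFDerivAt
        have du := (hu.differentiable (by norm_num) x).hasFDerivAt
        have hprod : ∀ w : RE d, fderiv ℝ v x w = (v x / Metric.infDist x K) *
            fderiv ℝ (fun y => Metric.infDist y K) x w + Metric.infDist x K *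
            fderiv ℝ (fun x => v x / Metric.infDist x K) x w := by
          intro w
          have hm := du.mul dρ
          have : v =ᶠ[𝓝 x] ((fun x => v x / Metric.infDist x K) * fun y => Metric.infDist y K) := by
            filter_upwards [hKcl.isOpen_compl.mem_nhds (hSK hx)] with y hy
            have := rel_pos hKne hKcl hy
            simp only [Pi.mul_apply]; field_simp
          rw [this.fderiv_eq, hm.fderiv]
          simp
        unfold rB
        have : ∀ i : Fin d, fderiv ℝ (fun y => Metric.infDist y K) x (EuclideanSpace.single i 1) *
          fderiv ℝ v x (EuclideanSpace.single i 1) =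
          fderiv ℝ (rq K) x (EuclideanSpace.single i 1) *
            fderiv ℝ (fun x => v x / Metric.infDist x K) x (EuclideanSpace.single i 1) +
          (v x / Metric.infDist x K) *
          fderiv ℝ (fun y => Metric.infDist y K) x (EuclideanSpace.single i 1) ^ 2 := by
          intro i
          rw [hprod, rel_rq_fderiv K hKne hKcl hKconv (hSK hx)]
          ring
        simp only [this]
        rw [Finset.sum_add_distrib, ← Finset.mul_sum, hg, mul_one]
      · unfold rB
        rw [rel_fderiv_zero hS.isClosed hv0 hx, rel_fderiv_zero hS.isClosed hu0 hx]
        simp [hv0 x hx]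
    have iB : Integrable (fun x => rB (rq K) (fun x => v x / Metric.infDist x K) x) := by
      unfold rB
      refine integrable_finsetSum _ fun i _ => ?_
      refine rel_integrable hS ?_ ?_
      · exact (rel_lip_fderiv_cont (fun x _ => hq.contDiffAt) _).mul
          (rel_lip_fderiv_cont (fun x _ => hu.contDiffAt) _)
      · intro x hx
        rw [rel_fderiv_zero hS.isClosed hu0 hx]; simp
    have iu : Integrable (fun x => v x / Metric.infDist x K) :=
      hu.continuous.integrable_of_hasCompactSupport (rel_hcs hS hu0)
    have : ∫ x, rB (fun y => Metric.infDist y K) v x =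
        (∫ x, rB (rq K) (fun x => v x / Metric.infDist x K) x) + ∫ x, v x / Metric.infDist x K := by
      rw [← integral_add iB iu]; exact integral_congr_ae (Eventually.of_forall hpt)
    rw [this]
    linarith

lemma rel_lapl {d : ℕ} {φ : RE d → ℝ} (hφ : ContDiff ℝ 2 φ) (x : RE d) :
    lapl φ x = ∑ i : Fin d, fderiv ℝ (fun y => fderiv ℝ φ y (EuclideanSpace.single i 1)) x
      (EuclideanSpace.single i 1) := by
  unfold lapl
  refine Finset.sum_congr rfl fun i _ => ?_
  rw [iteratedFDeriv_two_apply]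
  have h : DifferentiableAt ℝ (fderiv ℝ φ) x :=
    ((hφ.fderiv_right (m := 1) (by norm_num)).differentiable (by norm_num)) x
  rw [fderiv_clm_apply h (differentiableAt_const _)]
  simp

lemma rel_rB_integrable {d : ℕ} {S : Set (RE d)} (hS : IsCompact S) {f g : RE d → ℝ}
    (hf : ∀ x ∈ S, ContDiffAt ℝ 1 f x) (hg : ∀ x ∈ S, ContDiffAt ℝ 1 g x)
    (hg0 : ∀ x, x ∉ S → g x = 0) : Integrable (fun x => rB f g x) := by
  unfold rB
  refine integrable_finsetSum _ fun i _ => ?_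
  refine rel_integrable hS ?_ ?_
  · exact (rel_lip_fderiv_cont hf _).mul (rel_lip_fderiv_cont hg _)
  · intro x hx
    rw [rel_fderiv_zero hS.isClosed hg0 hx]; simp

lemma rel_rB_contOn {d : ℕ} {S : Set (RE d)} {f g : RE d → ℝ}
    (hf : ∀ x ∈ S, ContDiffAt ℝ 1 f x) (hg : ∀ x ∈ S, ContDiffAt ℝ 1 g x) :
    ContinuousOn (fun x => rB f g x) S := by
  unfold rB
  exact continuousOn_finsetSum _ fun i _ =>
    (rel_lip_fderiv_cont hf _).mul (rel_lip_fderiv_cont hg _)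

lemma rel_lapl_cont {d : ℕ} {φ : RE d → ℝ} (hφ : ContDiff ℝ 2 φ) : Continuous (lapl φ) := by
  have : lapl φ = fun x => lapl φ x := rfl
  rw [this]
  simp only [rel_lapl hφ]
  refine continuous_finsetSum _ fun i _ => ?_
  have h : ContDiff ℝ 1 (fun y => fderiv ℝ φ y (EuclideanSpace.single i 1)) :=
    (hφ.fderiv_right (m := 1) (by norm_num)).clm_apply contDiff_const
  exact (h.continuous_fderiv (by norm_num)).clm_apply continuous_const

lemma rel_lapl_zero {d : ℕ} {φ : RE d → ℝ} (hφ : ContDiff ℝ 2 φ) {x : RE d}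
    (hx : x ∉ tsupport φ) : lapl φ x = 0 := by
  rw [rel_lapl hφ]
  refine Finset.sum_eq_zero fun i _ => ?_
  rw [rel_fderiv_zero (S := tsupport φ) (isClosed_tsupport φ) _ hx]
  · simp
  · intro y hy
    rw [rel_fderiv_zero (isClosed_tsupport φ) (fun z hz => image_eq_zero_of_notMem_tsupport hz) hy]
    simp

/-- integration by parts -/
lemma rel_ibp {d : ℕ} {φ η : RE d → ℝ} (hφ : ContDiff ℝ 2 φ) {S : Set (RE d)} (hS : IsCompact S)
    (hη : ContDiff ℝ 1 η) (hη0 : ∀ x, x ∉ S → η x = 0) :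
    ∫ x, η x * lapl φ x = - ∫ x, rB η φ x := by
  have hcs : HasCompactSupport η := rel_hcs hS hη0
  have hηc := hη.continuous
  have hg : ∀ i : Fin d, ContDiff ℝ 1 (fun y => fderiv ℝ φ y (EuclideanSpace.single i 1)) :=
    fun i => (hφ.fderiv_right (m := 1) (by norm_num)).clm_apply contDiff_const
  have i1 : ∀ i : Fin d, Integrable (fun x => fderiv ℝ η x (EuclideanSpace.single i 1) *
      fderiv ℝ φ x (EuclideanSpace.single i 1)) := by
    intro i
    refine rel_integrable hS ?_ ?_
    · exact (rel_lip_fderiv_cont (fun x _ => hη.contDiffAt) _).mul (hg i).continuous.continuousOn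
    · intro x hx
      rw [rel_fderiv_zero hS.isClosed hη0 hx]; simp
  have i2 : ∀ i : Fin d, Integrable (fun x => η x *
      fderiv ℝ (fun y => fderiv ℝ φ y (EuclideanSpace.single i 1)) x
        (EuclideanSpace.single i 1)) := by
    intro i
    refine rel_integrable hS ?_ ?_
    · exact hηc.continuousOn.mul (rel_lip_fderiv_cont (fun x _ => (hg i).contDiffAt) _)
    · intro x hx
      simp [hη0 x hx]
  simp only [rel_lapl hφ, rB, Finset.mul_sum]
  rw [integral_finsetSum _ fun i _ => i2 i, integral_finsetSum _ fun i _ => i1 i,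
    ← Finset.sum_neg_distrib]
  refine Finset.sum_congr rfl fun i _ => ?_
  refine integral_mul_fderiv_eq_neg_fderiv_mul_of_integrable (i1 i) (i2 i) ?_
    (fun x _ => hη.differentiable (by norm_num) x)
    (fun x _ => (hg i).differentiable (by norm_num) x)
  exact rel_integrable hS (hηc.continuousOn.mul (hg i).continuous.continuousOn)
    (fun x hx => by simp [hη0 x hx])

lemma rel_key4 {d : ℕ} (hd : 1 ≤ d) (K : Set (RE d))
    (hKne : K.Nonempty) (hKcl : IsClosed K) (hKconv : Convex ℝ K)
    (dH : ℕ) (hdH : dH = min (Module.finrank ℝ (affineSpan ℝ K).direction) (d - 1))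
    (c w F : ℝ → ℝ) (hc : ∀ s, 0 < s → ContDiffAt ℝ 1 c s) (hw : ∀ s, 0 < s → ContDiffAt ℝ 1 w s)
    (hF : ∀ s, 0 < s → ContDiffAt ℝ 1 F s) (hFw : ∀ s, 0 < s → F s = - (c s * deriv w s))
    (hc0 : ∀ s, 0 < s → 0 ≤ c s) (hw0 : ∀ s, 0 < s → 0 ≤ w s) (hF0 : ∀ s, 0 < s → 0 ≤ F s)
    (b : ℝ → ℝ) (hb : ∀ s, 0 < s → ContinuousAt b s)
    (hbF : ∀ s, 0 < s → b s ≤ deriv F s + ((d : ℝ) - dH - 1) * (F s / s))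
    (G P : ℝ → ℝ) (hG : ContDiff ℝ 1 G) (hP : ContDiff ℝ 1 P) (hPG : ∀ s, deriv P s = G s)
    (hG' : ∀ s, 0 ≤ deriv G s) (hG0 : G 0 = 0) (hP0 : P 0 = 0) (hPn : ∀ s, 0 ≤ P s)
    (φ : RE d → ℝ) (hφ : ContDiff ℝ 2 φ) (hφc : HasCompactSupport φ) (hφK : tsupport φ ⊆ Kᶜ) :
    ∫ x, b (Metric.infDist x K) * P (φ x) ≤
    ∫ x, (-(c (Metric.infDist x K)) * lapl φ x - rB (fun y => c (Metric.infDist y K)) φ x) *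
      (w (Metric.infDist x K) * G (φ x)) := by
  set S := tsupport φ with hSdef
  have hS : IsCompact S := hφc
  have hφ0 : ∀ x, x ∉ S → φ x = 0 := fun x hx => image_eq_zero_of_notMem_tsupport hx
  set ρ : RE d → ℝ := fun y => Metric.infDist y K with hρ
  have hρd : ∀ x ∈ S, ContDiffAt ℝ 1 ρ x := fun x hx =>
    rel_dist_contDiffAt K hKne hKcl hKconv (hφK hx)
  have hρp : ∀ x ∈ S, 0 < ρ x := fun x hx => rel_pos hKne hKcl (hφK hx)
  have hφ1 : ∀ x, ContDiffAt ℝ 1 φ x := fun x => (hφ.of_le (by norm_num)).contDiffAt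
  have cρ : ∀ x ∈ S, ContDiffAt ℝ 1 (fun y => c (ρ y)) x := fun x hx =>
    (hc _ (hρp x hx)).comp x (hρd x hx)
  have wρ : ∀ x ∈ S, ContDiffAt ℝ 1 (fun y => w (ρ y)) x := fun x hx =>
    (hw _ (hρp x hx)).comp x (hρd x hx)
  have Fρ : ∀ x ∈ S, ContDiffAt ℝ 1 (fun y => F (ρ y)) x := fun x hx =>
    (hF _ (hρp x hx)).comp x (hρd x hx)
  have Gφ : ∀ x, ContDiffAt ℝ 1 (fun y => G (φ y)) x := fun x => hG.contDiffAt.comp x (hφ1 x)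
  have Pφ : ∀ x, ContDiffAt ℝ 1 (fun y => P (φ y)) x := fun x => hP.contDiffAt.comp x (hφ1 x)
  set η : RE d → ℝ := fun y => c (ρ y) * w (ρ y) * G (φ y) with hη
  set v : RE d → ℝ := fun y => F (ρ y) * P (φ y) with hv
  have hη0 : ∀ x, x ∉ S → η x = 0 := fun x hx => by simp [hη, hφ0 x hx, hG0]
  have hv0 : ∀ x, x ∉ S → v x = 0 := fun x hx => by simp [hv, hφ0 x hx, hP0]
  have hη1 : ContDiff ℝ 1 η := rel_contDiff hS.isClosed
    (fun x hx => ((cρ x hx).mul (wρ x hx)).mul (Gφ x)) hη0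
  have hv1 : ContDiff ℝ 1 v := rel_contDiff hS.isClosed (fun x hx => (Fρ x hx).mul (Pφ x)) hv0
  have hvn : ∀ x, 0 ≤ v x := fun x => by
    by_cases hx : x ∈ S
    · exact mul_nonneg (hF0 _ (hρp x hx)) (hPn _)
    · rw [hv0 x hx]
  have key := rel_key3 hd K hKne hKcl hKconv dH hdH hS hφK hv1 hv0 hvn
  have ibp := rel_ibp hφ hS hη1 hη0
  -- integrability
  have I1 : Integrable (fun x => η x * lapl φ x) :=
    rel_integrable hS (hη1.continuous.continuousOn.mul (rel_lapl_cont hφ).continuousOn)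
      (fun x hx => by simp [hη0 x hx])
  have I2 : Integrable (fun x => rB (fun y => c (ρ y)) φ x * (w (ρ x) * G (φ x))) :=
    rel_integrable hS ((rel_rB_contOn cρ fun x _ => hφ1 x).mul
      (ContinuousOn.mul (fun x hx => (wρ x hx).continuousAt.continuousWithinAt)
        (fun x hx => (Gφ x).continuousAt.continuousWithinAt)))
      (fun x hx => by simp [hφ0 x hx, hG0])
  have I3 : Integrable (fun x => rB η φ x) :=
    rel_rB_integrable hS (fun x _ => hη1.contDiffAt) (fun x _ => hφ1 x) hφ0
  have I4 : Integrable (fun x => rB ρ v x) :=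
    rel_rB_integrable hS hρd (fun x _ => hv1.contDiffAt) hv0
  have hderF : ContinuousOn (fun x => deriv F (ρ x)) S := fun x hx => by
    have h1 : ContinuousAt (deriv F) (ρ x) := by
      have : ContinuousAt (fun s => fderiv ℝ F s 1) (ρ x) :=
        (((hF _ (hρp x hx)).fderiv_right (m := 0) (by norm_num)).continuousAt).clm_apply
          continuousAt_const
      exact this
    exact (ContinuousAt.comp (f := ρ) h1 (hρd x hx).continuousAt).continuousWithinAt
  have I5 : Integrable (fun x => deriv F (ρ x) * P (φ x)) :=
    rel_integrable hS (hderF.mul (fun x hx => (Pφ x).continuousAt.continuousWithinAt))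
      (fun x hx => by simp [hφ0 x hx, hP0])
  have I6 : Integrable (fun x => v x / ρ x) :=
    rel_integrable hS (hv1.continuous.continuousOn.div
      (fun x hx => (hρd x hx).continuousAt.continuousWithinAt) fun x hx => (hρp x hx).ne')
      (fun x hx => by simp [hv0 x hx])
  have E1 : ∫ x, (deriv F (ρ x) + ((d : ℝ) - dH - 1) * (F (ρ x) / ρ x)) * P (φ x) =
      (∫ x, deriv F (ρ x) * P (φ x)) + ((d : ℝ) - dH - 1) * ∫ x, v x / ρ x := by
    rw [← integral_const_mul, ← integral_add I5 (I6.const_mul _)]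
    congr 1; ext x; simp only [hv]; ring
  have E2 : ∫ x, (-(c (ρ x)) * lapl φ x - rB (fun y => c (ρ y)) φ x) * (w (ρ x) * G (φ x)) =
      (∫ x, rB η φ x) - ∫ x, rB (fun y => c (ρ y)) φ x * (w (ρ x) * G (φ x)) := by
    have : ∫ x, rB η φ x = ∫ x, -(η x * lapl φ x) := by rw [integral_neg, ibp, neg_neg]
    have I1' : Integrable (fun x => -(η x * lapl φ x)) := I1.neg
    rw [this, ← integral_sub I1' I2]
    congr 1; ext x; simp only [hη]; ring
  have pt : ∀ x, deriv F (ρ x) * P (φ x) - rB ρ v x ≤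
      rB η φ x - rB (fun y => c (ρ y)) φ x * (w (ρ x) * G (φ x)) := by
    intro x
    by_cases hx : x ∈ S
    · have hp := hρp x hx
      have dρ := ((hρd x hx).differentiableAt (by norm_num)).hasFDerivAt
      have dφ := ((hφ1 x).differentiableAt (by norm_num)).hasFDerivAt
      have dc := ((hc _ hp).differentiableAt (by norm_num)).hasDerivAt.comp_hasFDerivAt x dρ
      have dw := ((hw _ hp).differentiableAt (by norm_num)).hasDerivAt.comp_hasFDerivAt x dρ
      have dF := ((hF _ hp).differentiableAt (by norm_num)).hasDerivAt.comp_hasFDerivAt x dρ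
      have dG := (hG.differentiable (by norm_num) (φ x)).hasDerivAt.comp_hasFDerivAt x dφ
      have dP := (hP.differentiable (by norm_num) (φ x)).hasDerivAt.comp_hasFDerivAt x dφ
      have fη : ∀ z, fderiv ℝ η x z = (c (ρ x) * deriv w (ρ x) + deriv c (ρ x) * w (ρ x)) *
          G (φ x) * fderiv ℝ ρ x z + c (ρ x) * w (ρ x) * deriv G (φ x) * fderiv ℝ φ x z := by
        intro z
        have h := ((dc.mul dw).mul dG).fderiv
        have : fderiv ℝ η x = _ := h
        rw [this]
        simp
        ring
      have fv : ∀ z, fderiv ℝ v x z = deriv F (ρ x) * P (φ x) * fderiv ℝ ρ x z +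
          F (ρ x) * G (φ x) * fderiv ℝ φ x z := by
        intro z
        have h := (dF.mul dP).fderiv
        have : fderiv ℝ v x = _ := h
        rw [this]
        simp [hPG]
        ring
      have fc : ∀ z, fderiv ℝ (fun y => c (ρ y)) x z = deriv c (ρ x) * fderiv ℝ ρ x z := by
        intro z
        have : fderiv ℝ (fun y => c (ρ y)) x = _ := dc.fderiv
        rw [this]; simp
      have hg : ∑ i : Fin d, fderiv ℝ ρ x (EuclideanSpace.single i 1) ^ 2 = 1 :=
        rel_grad_sq K hKne hKcl hKconv (hφK hx)
      have b1 : rB ρ v x = deriv F (ρ x) * P (φ x) + F (ρ x) * G (φ x) * rB ρ φ x := by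
        have : deriv F (ρ x) * P (φ x) = deriv F (ρ x) * P (φ x) *
          ∑ i : Fin d, fderiv ℝ ρ x (EuclideanSpace.single i 1) ^ 2 := by rw [hg, mul_one]
        rw [this]
        unfold rB
        rw [Finset.mul_sum, Finset.mul_sum, ← Finset.sum_add_distrib]
        refine Finset.sum_congr rfl fun i _ => ?_
        rw [fv]; ring
      have b2 : rB η φ x = (c (ρ x) * deriv w (ρ x) + deriv c (ρ x) * w (ρ x)) *
          G (φ x) * rB ρ φ x + c (ρ x) * w (ρ x) * deriv G (φ x) * rB φ φ x := by
        unfold rB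
        rw [Finset.mul_sum, Finset.mul_sum, ← Finset.sum_add_distrib]
        refine Finset.sum_congr rfl fun i _ => ?_
        rw [fη]; ring
      have b3 : rB (fun y => c (ρ y)) φ x = deriv c (ρ x) * rB ρ φ x := by
        unfold rB
        rw [Finset.mul_sum]
        refine Finset.sum_congr rfl fun i _ => ?_
        rw [fc]; ring
      have b4 : 0 ≤ c (ρ x) * w (ρ x) * deriv G (φ x) * rB φ φ x := by
        refine mul_nonneg (mul_nonneg (mul_nonneg (hc0 _ hp) (hw0 _ hp)) (hG' _)) ?_
        exact Finset.sum_nonneg fun i _ => mul_self_nonneg _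
      rw [b1, b2, b3, hFw _ hp]
      linarith
    · simp only [rB, rel_fderiv_zero hS.isClosed hη0 hx, rel_fderiv_zero hS.isClosed hv0 hx,
        rel_fderiv_zero hS.isClosed hφ0 hx]
      simp [hφ0 x hx, hP0, hG0]
  have mono := integral_mono (I5.sub I4) (I3.sub I2) pt
  have m1 : ∫ x, (deriv F (ρ x) * P (φ x) - rB ρ v x) = _ := integral_sub I5 I4
  have m2 : ∫ x, (rB η φ x - rB (fun y => c (ρ y)) φ x * (w (ρ x) * G (φ x))) = _ :=
    integral_sub I3 I2
  simp only [Pi.sub_apply] at mono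
  rw [m1, m2] at mono
  have I7 : Integrable (fun x => b (ρ x) * P (φ x)) :=
    rel_integrable hS (ContinuousOn.mul
      (fun x hx => (ContinuousAt.comp (f := ρ) (hb _ (hρp x hx))
        (hρd x hx).continuousAt).continuousWithinAt)
      (fun x hx => (Pφ x).continuousAt.continuousWithinAt))
      (fun x hx => by simp [hφ0 x hx, hP0])
  have I8 : Integrable (fun x => (deriv F (ρ x) + ((d : ℝ) - dH - 1) * (F (ρ x) / ρ x)) *
      P (φ x)) := by
    refine (I5.add (I6.const_mul ((d : ℝ) - dH - 1))).congr (Eventually.of_forall fun x => ?_)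
    simp only [hv, Pi.add_apply]; ring
  have E3 := integral_mono I7 I8 (fun x => by
    by_cases hx : x ∈ S
    · exact mul_le_mul_of_nonneg_right (hbF _ (hρp x hx)) (hPn _)
    · simp [hφ0 x hx, hP0])
  rw [E1] at E3
  rw [E2]
  refine E3.trans ?_
  linarith

lemma rel_inner_grad {d : ℕ} (f g : RE d → ℝ) (x : RE d) :
    ⟪gradient f x, gradient g x⟫ = rB f g x := by
  have h : ∀ (f : RE d → ℝ) (i : Fin d), gradient f x i =
      fderiv ℝ f x (EuclideanSpace.single i 1) := by
    intro f i
    have : ⟪gradient f x, EuclideanSpace.single i (1:ℝ)⟫ = fderiv ℝ f x (EuclideanSpace.single i 1) := by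
      rw [gradient, InnerProductSpace.toDual_symm_apply]
    rw [← this, EuclideanSpace.inner_single_right]
    simp
  rw [PiLp.inner_apply]
  unfold rB
  refine Finset.sum_congr rfl fun i _ => ?_
  rw [← h, ← h]
  simp [mul_comm]

/-- regularised power -/
def rG (p ε s : ℝ) : ℝ := s * (s ^ 2 + ε) ^ (p / 2 - 1)

/-- regularised potential -/
def rP (p ε s : ℝ) : ℝ := ((s ^ 2 + ε) ^ (p / 2) - ε ^ (p / 2)) / p

lemma rel_base (ε q s : ℝ) (hε : 0 < ε) :
    HasDerivAt (fun s => (s ^ 2 + ε) ^ q) (2 * s * q * (s ^ 2 + ε) ^ (q - 1)) s := by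
  have h1 : HasDerivAt (fun s : ℝ => s ^ 2 + ε) (2 * s) s := by
    simpa using (hasDerivAt_pow 2 s).add_const ε
  have := h1.rpow_const (p := q) (Or.inl (by positivity))
  simpa using this

lemma rel_base_cd (ε q : ℝ) (hε : 0 < ε) : ContDiff ℝ 1 (fun s : ℝ => (s ^ 2 + ε) ^ q) := by
  refine ContDiff.rpow_const_of_ne (by fun_prop) fun s => ?_
  positivity

lemma rel_rG_cd (p ε : ℝ) (hε : 0 < ε) : ContDiff ℝ 1 (rG p ε) :=
  contDiff_id.mul (rel_base_cd ε _ hε)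

lemma rel_rP_cd (p ε : ℝ) (hε : 0 < ε) : ContDiff ℝ 1 (rP p ε) :=
  ((rel_base_cd ε _ hε).sub contDiff_const).div_const p

lemma rel_rP_deriv (p ε s : ℝ) (hp : 1 < p) (hε : 0 < ε) : deriv (rP p ε) s = rG p ε s := by
  have := (((rel_base ε (p / 2) s hε).sub_const (ε ^ (p / 2))).div_const p).deriv
  have h : deriv (rP p ε) s = _ := this
  rw [h, rG]
  field_simp

lemma rel_rG_deriv (p ε s : ℝ) (hp : 1 < p) (hε : 0 < ε) : 0 ≤ deriv (rG p ε) s := by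
  have := ((hasDerivAt_id s).mul (rel_base ε (p / 2 - 1) s hε)).deriv
  have h : deriv (rG p ε) s = _ := this
  rw [h]
  have hb : 0 < s ^ 2 + ε := by positivity
  have e : (s ^ 2 + ε) ^ (p / 2 - 1) = (s ^ 2 + ε) ^ (p / 2 - 1 - 1) * (s ^ 2 + ε) := by
    rw [← Real.rpow_add_one hb.ne']; congr 1; ring
  simp only [id]
  rw [e]
  have : 1 * ((s ^ 2 + ε) ^ (p / 2 - 1 - 1) * (s ^ 2 + ε)) +
      s * (2 * s * (p / 2 - 1) * (s ^ 2 + ε) ^ (p / 2 - 1 - 1)) =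
      (s ^ 2 + ε) ^ (p / 2 - 1 - 1) * ((p - 1) * s ^ 2 + ε) := by ring
  rw [this]
  have : 0 < p - 1 := by linarith
  positivity

lemma rel_rP_nonneg (p ε s : ℝ) (hp : 1 < p) (hε : 0 < ε) : 0 ≤ rP p ε s := by
  unfold rP
  refine div_nonneg (sub_nonneg.2 ?_) (by linarith)
  exact Real.rpow_le_rpow hε.le (by nlinarith [sq_nonneg s]) (by linarith)

lemma rel_rG_bound (p ε s : ℝ) (hp : 1 < p) (hε : 0 < ε) :
    |rG p ε s| ≤ (s ^ 2 + ε) ^ ((p - 1) / 2) := by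
  have hb : 0 < s ^ 2 + ε := by positivity
  unfold rG
  rw [abs_mul, abs_of_pos (Real.rpow_pos_of_pos hb _)]
  have h1 : |s| ≤ (s ^ 2 + ε) ^ (1 / 2 : ℝ) := by
    rw [← Real.sqrt_eq_rpow]; exact Real.abs_le_sqrt (by linarith)
  calc _ ≤ (s ^ 2 + ε) ^ (1 / 2 : ℝ) * (s ^ 2 + ε) ^ (p / 2 - 1) := by
        gcongr
    _ = _ := by rw [← Real.rpow_add hb]; congr 1; ring

/-- two-parameter power -/
def pw (a b s : ℝ) : ℝ := s ^ a * (1 + s) ^ b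

lemma pw_cd (a b s : ℝ) (hs : 0 < s) : ContDiffAt ℝ 1 (pw a b) s := by
  unfold pw
  refine ContDiffAt.mul ?_ ?_
  · exact contDiffAt_id.rpow_const_of_ne hs.ne'
  · exact (contDiffAt_const.add contDiffAt_id).rpow_const_of_ne (by simp only [id]; positivity)

lemma pw_pos (a b s : ℝ) (hs : 0 < s) : 0 < pw a b s := by unfold pw; positivity

lemma pw_mul (a b a' b' s : ℝ) (hs : 0 < s) : pw a b s * pw a' b' s = pw (a + a') (b + b') s := by
  unfold pw
  rw [Real.rpow_add hs, Real.rpow_add (by positivity)]; ring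

lemma pw_rpow (a b s q : ℝ) (hs : 0 < s) : (pw a b s) ^ q = pw (a * q) (b * q) s := by
  unfold pw
  rw [Real.mul_rpow (by positivity) (by positivity), Real.rpow_mul hs.le,
    Real.rpow_mul (by positivity)]

lemma pw_sub_left (a b s : ℝ) (hs : 0 < s) : pw (a - 1) b s = pw a b s / s := by
  unfold pw
  rw [Real.rpow_sub_one hs.ne']; ring

lemma pw_sub_right (a b s : ℝ) (hs : 0 < s) : pw a (b - 1) s = pw a b s / (1 + s) := by
  unfold pw
  rw [Real.rpow_sub_one (by positivity)]; ring

lemma pw_deriv (a b s : ℝ) (hs : 0 < s) :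
    HasDerivAt (pw a b) (pw a b s * (a / s + b / (1 + s))) s := by
  have h1 : HasDerivAt (fun s : ℝ => s ^ a) (a * s ^ (a - 1)) s :=
    Real.hasDerivAt_rpow_const (Or.inl hs.ne')
  have h2 : HasDerivAt (fun s : ℝ => (1 + s) ^ b) (1 * b * (1 + s) ^ (b - 1)) s :=
    ((hasDerivAt_id s).const_add 1).rpow_const (Or.inl (by simp only [id]; positivity))
  have h3 := h1.mul h2
  have e : pw a b = (fun s : ℝ => s ^ a) * (fun s : ℝ => (1 + s) ^ b) := rfl
  rw [e]
  refine h3.congr_deriv ?_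
  rw [Real.rpow_sub_one hs.ne', Real.rpow_sub_one (by positivity)]
  simp only [Pi.mul_apply]
  have : (1 + s) ≠ 0 := by positivity
  field_simp

/-- the radial field -/
def rF (p δ τ s : ℝ) : ℝ := (p - 1) * ((2 - δ) * pw (δ * p - 2 * p + 2 - 1) (τ * p) s
  - τ * pw (δ * p - 2 * p + 2) (τ * p - 1) s)

lemma rF_cd (p δ τ s : ℝ) (hs : 0 < s) : ContDiffAt ℝ 1 (rF p δ τ) s :=
  contDiffAt_const.mul ((contDiffAt_const.mul (pw_cd _ _ s hs)).sub
    (contDiffAt_const.mul (pw_cd _ _ s hs)))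

lemma rF_eq (p δ τ s : ℝ) (hs : 0 < s) : rF p δ τ s =
    (p - 1) * (pw (δ * p - 2 * p + 2) (τ * p) s / s) * (2 - (δ + τ * (s / (1 + s)))) := by
  unfold rF
  rw [pw_sub_left _ _ _ hs, pw_sub_right _ _ _ hs]
  have : (1 + s) ≠ 0 := by positivity
  field_simp
  ring

lemma rF_w (p δ τ s : ℝ) (hs : 0 < s) : rF p δ τ s =
    -(pw δ τ s * deriv (pw ((δ - 2) * (p - 1)) (τ * (p - 1))) s) := by
  rw [(pw_deriv _ _ s hs).deriv, ← mul_assoc, pw_mul _ _ _ _ _ hs]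
  have e1 : δ + (δ - 2) * (p - 1) = δ * p - 2 * p + 2 := by ring
  have e2 : τ + τ * (p - 1) = τ * p := by ring
  rw [e1, e2, rF_eq _ _ _ _ hs]
  have : (1 + s) ≠ 0 := by positivity
  field_simp
  ring

lemma rel_conv (δ δ' t : ℝ) (h0 : 0 ≤ t) (h1 : t ≤ 1) :
    min δ δ' ≤ δ + (δ' - δ) * t ∧ δ + (δ' - δ) * t ≤ max δ δ' := by
  rcases le_total δ δ' with h | h
  · rw [min_eq_left h, max_eq_right h]
    constructor <;> nlinarith
  · rw [min_eq_right h, max_eq_left h]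
    constructor <;> nlinarith

lemma rF_nonneg (p δ δ' s : ℝ) (hp : 1 < p) (hδ2 : δ < 2) (hδ'2 : δ' < 2) (hs : 0 < s) :
    0 ≤ rF p δ (δ' - δ) s := by
  rw [rF_eq _ _ _ _ hs]
  have := (rel_conv δ δ' (s / (1 + s)) (by positivity)
    (by rw [div_le_one (by positivity)]; linarith)).2
  have h2 : max δ δ' < 2 := max_lt hδ2 hδ'2
  have := pw_pos (δ * p - 2 * p + 2) ((δ' - δ) * p) s hs
  refine mul_nonneg (mul_nonneg (by linarith) (by positivity)) (by linarith)

lemma rF_ineq (p δ δ' D s : ℝ) (hp : 1 < p) (hδ2 : δ < 2) (hδ'2 : δ' < 2) (hs : 0 < s)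
    (ha : 0 < D + p * min δ δ' - 2 * p) :
    (p - 1) * ((D + p * min δ δ' - 2 * p) * (2 - max δ δ') - |δ - δ'|) *
      (pw (δ * p - 2 * p + 2) ((δ' - δ) * p) s / s ^ 2) ≤
    deriv (rF p δ (δ' - δ)) s + (D - 1) * (rF p δ (δ' - δ) s / s) := by
  set t := s / (1 + s) with ht
  have t0 : 0 ≤ t := by positivity
  have t1 : t ≤ 1 := by rw [ht, div_le_one (by positivity)]; linarith
  obtain ⟨m1, m2⟩ := rel_conv δ δ' t t0 t1
  have h2 : max δ δ' < 2 := max_lt hδ2 hδ'2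
  have hM := pw_pos (δ * p - 2 * p + 2) ((δ' - δ) * p) s hs
  have hd : deriv (rF p δ (δ' - δ)) s = _ :=
    ((((pw_deriv (δ * p - 2 * p + 2 - 1) ((δ' - δ) * p) s hs).const_mul (2 - δ)).sub
    ((pw_deriv (δ * p - 2 * p + 2) ((δ' - δ) * p - 1) s hs).const_mul (δ' - δ))).const_mul
      (p - 1)).deriv
  rw [hd, rF_eq _ _ _ _ hs, pw_sub_left _ _ _ hs, pw_sub_right _ _ _ hs, ← ht]
  set M := pw (δ * p - 2 * p + 2) ((δ' - δ) * p) s with hMdef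
  set m := δ + (δ' - δ) * t with hm
  have hs1 : ∀ z : ℝ, z / (1 + s) = z * t / s := by
    intro z
    have : (1 + s) ≠ 0 := by positivity
    rw [ht]; field_simp
  have e : (p - 1) *
          ((2 - δ) * (M / s * ((δ * p - 2 * p + 2 - 1) / s + (δ' - δ) * p / (1 + s))) -
            (δ' - δ) * (M / (1 + s) * ((δ * p - 2 * p + 2) / s + ((δ' - δ) * p - 1) / (1 + s)))) +
      (D - 1) * ((p - 1) * (M / s) * (2 - m) / s) =
      (p - 1) * ((D + p * m - 2 * p) * (2 - m) - (δ' - δ) * t * (1 - t)) * (M / s ^ 2) := by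
    simp only [hs1, hm]
    field_simp
    ring
  rw [e]
  have k1 : (D + p * min δ δ' - 2 * p) * (2 - max δ δ') ≤ (D + p * m - 2 * p) * (2 - m) := by
    have : p * min δ δ' ≤ p * m := by gcongr
    apply mul_le_mul <;> linarith
  have k2 : (δ' - δ) * t * (1 - t) ≤ |δ - δ'| := by
    have : (δ' - δ) ≤ |δ - δ'| := by rw [abs_sub_comm]; exact le_abs_self _
    have h3 : t * (1 - t) ≤ 1 := by nlinarith
    have h4 : 0 ≤ t * (1 - t) := mul_nonneg t0 (by linarith)
    calc _ = (δ' - δ) * (t * (1 - t)) := by ring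
      _ ≤ |δ - δ'| * (t * (1 - t)) := by gcongr
      _ ≤ |δ - δ'| * 1 := by gcongr
      _ = _ := mul_one _
  have : 0 ≤ p - 1 := by linarith
  gcongr

lemma rel_sq_rpow (s q : ℝ) : (s ^ 2) ^ (q / 2) = |s| ^ q := by
  rw [← sq_abs, ← Real.rpow_natCast, ← Real.rpow_mul (abs_nonneg _)]
  congr 1
  push_cast
  ring

/-- dominated convergence `ε → 0` -/
lemma rel_limit {d : ℕ} {S : Set (RE d)} (hS : IsCompact S) (A φ : RE d → ℝ)
    (hA : ContinuousOn A S) (hA0 : ∀ x, x ∉ S → A x = 0) (hφ : Continuous φ) (q : ℝ) (hq : 0 < q) :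
    Tendsto (fun n : ℕ => ∫ x, A x * ((φ x) ^ 2 + 1 / ((n : ℝ) + 1)) ^ (q / 2)) atTop
      (𝓝 (∫ x, A x * |φ x| ^ q)) := by
  have hcont : ∀ ε : ℝ, ContinuousOn (fun x => A x * ((φ x) ^ 2 + ε) ^ (q / 2)) S := fun ε =>
    hA.mul (Continuous.continuousOn
      (Continuous.rpow_const (by fun_prop) fun x => Or.inr (by positivity)))
  refine tendsto_integral_of_dominated_convergence
    (fun x => |A x * ((φ x) ^ 2 + 1) ^ (q / 2)|) ?_ ?_ ?_ ?_
  · intro n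
    exact (rel_integrable hS (hcont _) fun x hx => by simp [hA0 x hx]).aestronglyMeasurable
  · exact (rel_integrable hS (hcont 1) fun x hx => by simp [hA0 x hx]).abs
  · intro n
    refine Eventually.of_forall fun x => ?_
    rw [Real.norm_eq_abs, abs_mul, abs_mul]
    have h1 : 1 / ((n : ℝ) + 1) ≤ 1 := by
      rw [div_le_one (by positivity)]; linarith [n.cast_nonneg (α := ℝ)]
    have h0 : 0 < 1 / ((n : ℝ) + 1) := by positivity
    rw [abs_of_nonneg (by positivity : 0 ≤ ((φ x) ^ 2 + 1 / ((n : ℝ) + 1)) ^ (q / 2)),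
      abs_of_nonneg (by positivity : 0 ≤ ((φ x) ^ 2 + 1) ^ (q / 2))]
    gcongr
  · refine Eventually.of_forall fun x => ?_
    refine Tendsto.const_mul _ ?_
    rw [← rel_sq_rpow]
    refine Tendsto.rpow_const ?_ (Or.inr (by positivity))
    have := (tendsto_one_div_add_atTop_nhds_zero_nat (𝕜 := ℝ)).const_add ((φ x) ^ 2)
    simpa using this

lemma rel_young (A B p c : ℝ) (hp : 1 < p) (hA : 0 ≤ A) (hB : 0 ≤ B) (hc : 0 < c) :
    A * B ^ (p - 1) ≤ c * (c⁻¹ ^ p * A ^ p / p + (1 - 1 / p) * B ^ p) := by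
  have hpq := Real.HolderConjugate.conjExponent hp
  have h := Real.young_inequality_of_nonneg (a := c⁻¹ * A) (b := B ^ (p - 1))
    (by positivity) (by positivity) hpq
  have hp1 : p - 1 ≠ 0 := by linarith
  have hp0 : p ≠ 0 := by linarith
  rw [Real.mul_rpow (by positivity) hA, ← Real.rpow_mul hB, Real.conjExponent,
    mul_div_cancel₀ _ hp1] at h
  have e : B ^ p / (p / (p - 1)) = (1 - 1 / p) * B ^ p := by field_simp
  rw [e] at h
  calc A * B ^ (p - 1) = c * (c⁻¹ * A * B ^ (p - 1)) := by field_simp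
    _ ≤ _ := by gcongr

end RellichAux

/-- Weighted Rellich inequality on the complement of a closed convex set
(Theorem 1.2 of the paper). -/
theorem rellich_inequality_complement_convex
    (d : ℕ) (hd : 1 ≤ d) (K : Set (EuclideanSpace ℝ (Fin d)))
    (hKne : K.Nonempty) (hKcl : IsClosed K) (hKconv : Convex ℝ K)
    (hKproper : K ≠ Set.univ)
    (dH : ℕ) (hdH : dH = min (Module.finrank ℝ (affineSpan ℝ K).direction) (d - 1))
    (p δ δ' : ℝ) (hp : 1 < p)
    (hδ0 : 0 ≤ δ) (hδ2 : δ < 2) (hδ'0 : 0 ≤ δ') (hδ'2 : δ' < 2)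
    (hcond : ((d : ℝ) - dH + p * min δ δ' - 2 * p) * (2 - max δ δ') > 2 * p * |δ - δ'|) :
    ∃ cp : ℝ, 0 < cp ∧
      cp ≤ (p - 1) * ((d : ℝ) - dH) * ((d : ℝ) - dH + p * min δ δ' - 2 * p) / p ^ 2 ∧
      ∀ φ : EuclideanSpace ℝ (Fin d) → ℝ, ContDiff ℝ 2 φ → HasCompactSupport φ →
        tsupport φ ⊆ Kᶜ →
        (∫ x in Kᶜ, |Hop K δ δ' φ x| ^ p)
          ≥ cp ^ p * ∫ x in Kᶜ,
              |cWeight K δ δ' x * Metric.infDist x K ^ (-(2 : ℝ)) * φ x| ^ p := by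
  classical
  set D : ℝ := (d : ℝ) - dH with hD
  have hD1 : 1 ≤ D := by
    have : dH + 1 ≤ d := by omega
    have : (dH : ℝ) + 1 ≤ d := by exact_mod_cast this
    rw [hD]; linarith
  have hmax : max δ δ' < 2 := max_lt hδ2 hδ'2
  have ha : 0 < D + p * min δ δ' - 2 * p := by
    have h1 : 0 ≤ 2 * p * |δ - δ'| := by positivity
    have h2 : 0 < (D + p * min δ δ' - 2 * p) * (2 - max δ δ') := lt_of_le_of_lt h1 hcond
    exact pos_of_mul_pos_left h2 (by linarith)
  set κ : ℝ := (p - 1) * ((D + p * min δ δ' - 2 * p) * (2 - max δ δ') - |δ - δ'|) with hκ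
  have hp1 : 0 < p - 1 := by linarith
  have hp0 : 0 < p := by linarith
  have hκ0 : 0 < κ := by
    refine mul_pos hp1 ?_
    have : |δ - δ'| ≤ 2 * p * |δ - δ'| := by nlinarith [abs_nonneg (δ - δ')]
    linarith
  have hC : 0 < (p - 1) * D * (D + p * min δ δ' - 2 * p) / p ^ 2 := by positivity
  set C := (p - 1) * D * (D + p * min δ δ' - 2 * p) / p ^ 2 with hCdef
  have hcp0 : 0 < min (κ / p) C := lt_min (by positivity) hC
  refine ⟨min (κ / p) C, hcp0, min_le_right _ _, ?_⟩
  set cp := min (κ / p) C with hcp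
  intro φ hφ hφc hφK
  set S := tsupport φ with hSdef
  have hS : IsCompact S := hφc
  have hφ0 : ∀ x, x ∉ S → φ x = 0 := fun x hx => image_eq_zero_of_notMem_tsupport hx
  have hφcont : Continuous φ := hφ.continuous
  have hρd : ∀ x ∈ S, ContDiffAt ℝ 1 (fun y => Metric.infDist y K) x := fun x hx =>
    rel_dist_contDiffAt K hKne hKcl hKconv (hφK hx)
  have hρp : ∀ x ∈ S, 0 < Metric.infDist x K := fun x hx => rel_pos hKne hKcl (hφK hx)
  have hcW : cWeight K δ δ' = fun y => pw δ (δ' - δ) (Metric.infDist y K) := rfl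
  have hcd : ∀ a b, ∀ x ∈ S, ContDiffAt ℝ 1 (fun y => pw a b (Metric.infDist y K)) x :=
    fun a b x hx => ContDiffAt.comp (g := pw a b) (f := fun y => Metric.infDist y K) x
      (pw_cd a b _ (hρp x hx)) (hρd x hx)
  have hcc : ∀ a b, ContinuousOn (fun y => pw a b (Metric.infDist y K)) S :=
    fun a b x hx => (hcd a b x hx).continuousAt.continuousWithinAt
  set Hx : EuclideanSpace ℝ (Fin d) → ℝ := Hop K δ δ' φ with hHx
  have hH : ∀ x, Hx x = -(pw δ (δ' - δ) (Metric.infDist x K)) * lapl φ x -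
      rB (fun y => pw δ (δ' - δ) (Metric.infDist y K)) φ x := by
    intro x
    rw [hHx, Hop, rel_inner_grad, hcW]
  have hHc : ContinuousOn Hx S := by
    have : Hx = fun x => Hx x := rfl
    rw [this]
    simp only [hH]
    exact (((hcc _ _).neg).mul (rel_lapl_cont hφ).continuousOn).sub
      (rel_rB_contOn (hcd _ _) fun x _ => (hφ.of_le (by norm_num)).contDiffAt)
  have hH0 : ∀ x, x ∉ S → Hx x = 0 := by
    intro x hx
    rw [hH, rel_lapl_zero hφ hx, rB]
    simp [rel_fderiv_zero hS.isClosed hφ0 hx]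
  set α := δ * p - 2 * p + 2 with hα
  set β := (δ' - δ) * p with hβ
  set wt : EuclideanSpace ℝ (Fin d) → ℝ := fun x =>
    pw ((δ - 2) * (p - 1)) ((δ' - δ) * (p - 1)) (Metric.infDist x K) with hwt
  set bb : EuclideanSpace ℝ (Fin d) → ℝ := fun x =>
    pw α β (Metric.infDist x K) / (Metric.infDist x K) ^ 2 with hbb
  have hbc : ContinuousOn bb S := (hcc _ _).div
    (ContinuousOn.pow (fun x hx => (hρd x hx).continuousAt.continuousWithinAt) 2)
    (fun x hx => by have := hρp x hx; positivity)
  -- indicator version to vanish off S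
  have step : ∀ ε : ℝ, 0 < ε → ∫ x, κ * bb x * rP p ε (φ x) ≤
      ∫ x, |Hx x| * wt x * ((φ x) ^ 2 + ε) ^ ((p - 1) / 2) := by
    intro ε hε
    have key := rel_key4 hd K hKne hKcl hKconv dH hdH (pw δ (δ' - δ))
      (pw ((δ - 2) * (p - 1)) ((δ' - δ) * (p - 1))) (rF p δ (δ' - δ))
      (fun s hs => pw_cd _ _ s hs) (fun s hs => pw_cd _ _ s hs) (fun s hs => rF_cd _ _ _ s hs)
      (fun s hs => rF_w _ _ _ s hs) (fun s hs => (pw_pos _ _ s hs).le)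
      (fun s hs => (pw_pos _ _ s hs).le) (fun s hs => rF_nonneg p δ δ' s hp hδ2 hδ'2 hs)
      (fun s => κ * (pw α β s / s ^ 2))
      (fun s hs => continuousAt_const.mul ((pw_cd α β s hs).continuousAt.div
        (continuousAt_id.pow 2) (pow_ne_zero 2 (ne_of_gt hs))))
      (fun s hs => rF_ineq p δ δ' D s hp hδ2 hδ'2 hs ha)
      (rG p ε) (rP p ε) (rel_rG_cd p ε hε) (rel_rP_cd p ε hε)
      (fun s => rel_rP_deriv p ε s hp hε) (fun s => rel_rG_deriv p ε s hp hε)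
      (by simp [rG]) (by simp [rP]) (fun s => rel_rP_nonneg p ε s hp hε) φ hφ hφc hφK
    refine key.trans ?_
    simp only [← hH]
    have Gc : Continuous (fun x => rG p ε (φ x)) := (rel_rG_cd p ε hε).continuous.comp hφcont
    refine integral_mono ?_ ?_ fun x => ?_
    · exact rel_integrable hS (hHc.mul ((hcc _ _).mul Gc.continuousOn))
        (fun x hx => by simp [hH0 x hx])
    · refine rel_integrable hS ((hHc.abs.mul (hcc _ _)).mul (Continuous.continuousOn
        (Continuous.rpow_const (by fun_prop) fun x => Or.inl (by positivity))))
        (fun x hx => by simp [hH0 x hx])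
    · by_cases hx : x ∈ S
      · have hw := pw_pos ((δ - 2) * (p - 1)) ((δ' - δ) * (p - 1)) _ (hρp x hx)
        refine (le_abs_self _).trans ?_
        simp only [hwt]
        rw [abs_mul, abs_mul, abs_of_pos hw, mul_assoc]
        have := rel_rG_bound p ε (φ x) hp hε
        gcongr
      · simp [hH0 x hx]
  -- pass to the limit
  set b1 : EuclideanSpace ℝ (Fin d) → ℝ := S.indicator (fun x => κ / p * bb x) with hb1
  have b1S : ∀ x ∈ S, b1 x = κ / p * bb x := fun x hx => indicator_of_mem hx _
  have b10 : ∀ x, x ∉ S → b1 x = 0 := fun x hx => indicator_of_notMem hx _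
  have b1c : ContinuousOn b1 S := (continuousOn_const.mul hbc).congr b1S
  have b1i : Integrable b1 := rel_integrable hS b1c b10
  have L1 := rel_limit hS b1 φ b1c b10 hφcont p hp0
  have L2 := rel_limit hS (fun x => |Hx x| * wt x) φ (hHc.abs.mul (hcc _ _))
    (fun x hx => by simp [hH0 x hx]) hφcont (p - 1) hp1
  have L3 : Filter.Tendsto (fun n : ℕ => (∫ x, b1 x * ((φ x) ^ 2 + 1 / ((n : ℝ) + 1)) ^ (p / 2)) -
      (1 / ((n : ℝ) + 1)) ^ (p / 2) * ∫ x, b1 x) Filter.atTop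
      (nhds ((∫ x, b1 x * |φ x| ^ p) - 0 * ∫ x, b1 x)) := by
    refine L1.sub (Filter.Tendsto.mul_const _ ?_)
    have := (tendsto_one_div_add_atTop_nhds_zero_nat (𝕜 := ℝ)).rpow_const
      (p := p / 2) (Or.inr (by positivity))
    rwa [Real.zero_rpow (by positivity)] at this
  have lim : (∫ x, b1 x * |φ x| ^ p) - 0 * ∫ x, b1 x ≤ ∫ x, |Hx x| * wt x * |φ x| ^ (p - 1) := by
    refine le_of_tendsto_of_tendsto' L3 L2 fun n => ?_
    have hε : 0 < 1 / ((n : ℝ) + 1) := by positivity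
    refine le_trans (le_of_eq ?_) (step _ hε)
    rw [← integral_const_mul, ← integral_sub]
    · congr 1; ext x
      by_cases hx : x ∈ S
      · rw [b1S x hx, rP]; ring
      · rw [b10 x hx, hφ0 x hx]; simp [rP]
    · exact rel_integrable hS (b1c.mul (Continuous.continuousOn
        (Continuous.rpow_const (by fun_prop) fun x => Or.inl (by positivity))))
        (fun x hx => by simp [b10 x hx])
    · exact b1i.const_mul _
  rw [zero_mul, sub_zero] at lim
  -- identify
  set B : EuclideanSpace ℝ (Fin d) → ℝ := fun x =>
    |cWeight K δ δ' x * Metric.infDist x K ^ (-(2 : ℝ)) * φ x| with hB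
  have hB0 : ∀ x, x ∉ S → B x = 0 := fun x hx => by simp [hB, hφ0 x hx]
  have hBeq : ∀ x ∈ S, B x = pw (δ - 2) (δ' - δ) (Metric.infDist x K) * |φ x| := by
    intro x hx
    have hp := hρp x hx
    simp only [hB]
    have : cWeight K δ δ' x * Metric.infDist x K ^ (-(2 : ℝ)) =
        pw (δ - 2) (δ' - δ) (Metric.infDist x K) := by
      rw [cWeight, pw, sub_eq_add_neg δ 2, Real.rpow_add hp]; ring
    rw [this, abs_mul, abs_of_pos (pw_pos _ _ _ hp)]
  have hBp : ∀ x ∈ S, B x ^ p = bb x * |φ x| ^ p := by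
    intro x hx
    have hp := hρp x hx
    rw [hBeq x hx, Real.mul_rpow (pw_pos _ _ _ hp).le (abs_nonneg _), pw_rpow _ _ _ _ hp]
    simp only [hbb]
    have : (δ - 2) * p = α - 1 - 1 := by rw [hα]; ring
    rw [this, pw_sub_left _ _ _ hp, pw_sub_left _ _ _ hp, div_div, ← sq]
  have hBp1 : ∀ x ∈ S, B x ^ (p - 1) = wt x * |φ x| ^ (p - 1) := by
    intro x hx
    have hp := hρp x hx
    rw [hBeq x hx, Real.mul_rpow (pw_pos _ _ _ hp).le (abs_nonneg _), pw_rpow _ _ _ _ hp]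
  have hBc : ContinuousOn B S :=
    ((hcc (δ - 2) (δ' - δ)).mul hφcont.abs.continuousOn).congr hBeq
  have IB : Integrable (fun x => B x ^ p) := rel_integrable hS
    (hBc.rpow_const fun x _ => Or.inr hp0.le) (fun x hx => by
      rw [hB0 x hx, Real.zero_rpow hp0.ne'])
  have IH : Integrable (fun x => |Hx x| ^ p) := rel_integrable hS
    (hHc.abs.rpow_const fun x _ => Or.inr hp0.le) (fun x hx => by
      rw [hH0 x hx, abs_zero, Real.zero_rpow hp0.ne'])
  have IHB : Integrable (fun x => |Hx x| * B x ^ (p - 1)) := rel_integrable hS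
    (hHc.abs.mul (hBc.rpow_const fun x _ => Or.inr hp1.le)) (fun x hx => by
      simp [hH0 x hx])
  have E1 : ∫ x, b1 x * |φ x| ^ p = κ / p * ∫ x, B x ^ p := by
    rw [← integral_const_mul]
    congr 1; ext x
    by_cases hx : x ∈ S
    · rw [b1S x hx, hBp x hx]; ring
    · rw [b10 x hx, hB0 x hx, Real.zero_rpow hp0.ne']; simp
  have E2 : ∫ x, |Hx x| * wt x * |φ x| ^ (p - 1) = ∫ x, |Hx x| * B x ^ (p - 1) := by
    congr 1; ext x
    by_cases hx : x ∈ S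
    · rw [hBp1 x hx]; ring
    · simp [hH0 x hx]
  rw [E1, E2] at lim
  have hJ0 : 0 ≤ ∫ x, B x ^ p := integral_nonneg fun x => by
    have : 0 ≤ B x := abs_nonneg _
    exact Real.rpow_nonneg this p
  have hyoung : ∫ x, |Hx x| * B x ^ (p - 1) ≤
      cp * (cp⁻¹ ^ p * (∫ x, |Hx x| ^ p) / p + (1 - 1 / p) * ∫ x, B x ^ p) := by
    have I3 : Integrable (fun x => cp⁻¹ ^ p / p * |Hx x| ^ p) := IH.const_mul _
    have I4 : Integrable (fun x => (1 - 1 / p) * B x ^ p) := IB.const_mul _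
    have e : cp * (cp⁻¹ ^ p * (∫ x, |Hx x| ^ p) / p + (1 - 1 / p) * ∫ x, B x ^ p) =
        ∫ x, cp * (cp⁻¹ ^ p / p * |Hx x| ^ p + (1 - 1 / p) * B x ^ p) := by
      rw [integral_const_mul, integral_add I3 I4, integral_const_mul, integral_const_mul]
      ring
    rw [e]
    refine integral_mono IHB ((I3.add I4).const_mul cp) fun x => ?_
    refine (rel_young _ (B x) p cp hp (abs_nonneg (Hx x)) (abs_nonneg _) hcp0).trans_eq ?_
    ring
  have hle : cp * ∫ x, B x ^ p ≤ κ / p * ∫ x, B x ^ p :=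
    mul_le_mul_of_nonneg_right (min_le_left _ _) hJ0
  have hfin := le_of_mul_le_mul_left (hle.trans (lim.trans hyoung)) hcp0
  have R1 : ∫ x in Kᶜ, |Hx x| ^ p = ∫ x, |Hx x| ^ p :=
    setIntegral_eq_integral_of_forall_compl_eq_zero fun x hx => by
      rw [hH0 x fun h => hx (hφK h), abs_zero, Real.zero_rpow hp0.ne']
  have R2 : ∫ x in Kᶜ, B x ^ p = ∫ x, B x ^ p :=
    setIntegral_eq_integral_of_forall_compl_eq_zero fun x hx => by
      rw [hB0 x fun h => hx (hφK h), Real.zero_rpow hp0.ne']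
  change ∫ x in Kᶜ, |Hx x| ^ p ≥ cp ^ p * ∫ x in Kᶜ, B x ^ p
  rw [R1, R2]
  have hcpp : 0 < cp ^ p := Real.rpow_pos_of_pos hcp0 p
  rw [Real.inv_rpow hcp0.le] at hfin
  set J := ∫ x, B x ^ p
  set I := ∫ x, |Hx x| ^ p
  have h3 : J ≤ (cp ^ p)⁻¹ * I := by
    have : 1 / p * J ≤ 1 / p * ((cp ^ p)⁻¹ * I) := by
      have e : (cp ^ p)⁻¹ * I / p = 1 / p * ((cp ^ p)⁻¹ * I) := by ring
      rw [e] at hfin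
      linarith
    exact le_of_mul_le_mul_left this (by positivity)
  rw [inv_mul_eq_div, le_div_iff₀ hcpp] at h3
  linarith
end
end

section
/- Let p > 1 and δ, δ' ≥ 0 satisfy p − 1 − max(δ,δ') > 0, and set a_p = ((p − 1 − max(δ,δ'))/p)^p. Then for every φ ∈ C_c^1 with compact support contained in Ω ∩ G(Ω) one has ∫_Ω c_Ω |∇φ|^p ≥ ∫_Ω c_Ω |(∇d_Γ)·(∇φ)|^p ≥ a_p ∫_Ω c_Ω d_Γ^{−p} |φ|^p. -/
open MeasureTheory Set
open scoped RealInnerProductSpace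

noncomputable section

/-- The skeleton `S(Ω)` of an open convex set: the points of `Ω` with at least two
distinct nearest points on the boundary. -/
def skeleton {d : ℕ} (Ω : Set (EuclideanSpace ℝ (Fin d))) : Set (EuclideanSpace ℝ (Fin d)) :=
  {x ∈ Ω | ∃ y ∈ frontier Ω, ∃ z ∈ frontier Ω, y ≠ z ∧
    dist x y = Metric.infDist x Ωᶜ ∧ dist x z = Metric.infDist x Ωᶜ}

/-- `G(Ω) = ℝ^d \ closure(S(Ω))`. -/
def goodSet {d : ℕ} (Ω : Set (EuclideanSpace ℝ (Fin d))) : Set (EuclideanSpace ℝ (Fin d)) :=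
  (closure (skeleton Ω))ᶜ

open Filter Topology Metric

theorem hc_geo {d : ℕ} {Ω : Set (EuclideanSpace ℝ (Fin d))}
    (hΩo : IsOpen Ω) (hΩconv : Convex ℝ Ω) (hΩproper : Ω ≠ Set.univ)
    {x : EuclideanSpace ℝ (Fin d)} (hx : x ∈ Ω) :
    ∃ n : EuclideanSpace ℝ (Fin d), ‖n‖ = 1 ∧
      ∀ z ∈ Ω, infDist z Ωᶜ ≤ infDist x Ωᶜ + ⟪n, z - x⟫ := by
  have hne : (Ωᶜ).Nonempty := Set.nonempty_compl.2 hΩproper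
  obtain ⟨y, hy, hyd⟩ := hΩo.isClosed_compl.exists_infDist_eq_dist hne x
  obtain ⟨f, hf⟩ := geometric_hahn_banach_open_point hΩconv hΩo hy
  set w := (InnerProductSpace.toDual ℝ (EuclideanSpace ℝ (Fin d))).symm f with hw
  have hfw : ∀ z, f z = ⟪w, z⟫ := fun z => by
    rw [hw, InnerProductSpace.toDual_symm_apply]
  have hw0 : w ≠ 0 := by
    intro h0
    have := hf x hx
    simp [hfw, h0] at this
  have hwn : 0 < ‖w‖ := norm_pos_iff.2 hw0
  set n := (-‖w‖⁻¹) • w with hn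
  have hn1 : ‖n‖ = 1 := by
    rw [hn, norm_smul, norm_neg, norm_inv, norm_norm, inv_mul_cancel₀ hwn.ne']
  have hsep : ∀ a ∈ Ω, 0 < ⟪n, a - y⟫ := by
    intro a ha
    have h1 := hf a ha
    rw [hfw, hfw] at h1
    rw [hn, inner_smul_left, inner_sub_right]
    have : 0 < ‖w‖⁻¹ := inv_pos.2 hwn
    simp only [conj_trivial]
    nlinarith
  refine ⟨n, hn1, fun z hz => ?_⟩
  have h1 : z - ⟪n, z - y⟫ • n ∈ Ωᶜ := by
    intro h
    have := hsep _ h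
    rw [sub_right_comm, inner_sub_right, inner_smul_right, real_inner_self_eq_norm_sq, hn1] at this
    simp at this
  have h2 : infDist z Ωᶜ ≤ ⟪n, z - y⟫ := by
    refine (infDist_le_dist_of_mem h1).trans ?_
    rw [dist_eq_norm, sub_sub_cancel, norm_smul, hn1, mul_one, Real.norm_eq_abs,
      abs_of_pos (hsep z hz)]
  have h3 : ⟪n, x - y⟫ ≤ dist x y := by
    have := real_inner_le_norm n (x - y)
    rwa [hn1, one_mul, ← dist_eq_norm] at this
  have h4 : ⟪n, z - y⟫ = ⟪n, z - x⟫ + ⟪n, x - y⟫ := by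
    rw [← inner_add_right, sub_add_sub_cancel]
  rw [hyd]; linarith

theorem hc_grad {d : ℕ} {Ω : Set (EuclideanSpace ℝ (Fin d))}
    (hΩo : IsOpen Ω) (hΩconv : Convex ℝ Ω) (hΩproper : Ω ≠ Set.univ)
    {x : EuclideanSpace ℝ (Fin d)} (hx : x ∈ Ω)
    (hD : DifferentiableAt ℝ (fun y => infDist y Ωᶜ) x) :
    ‖gradient (fun y => infDist y Ωᶜ) x‖ = 1 ∧
      ∀ z ∈ Ω, infDist z Ωᶜ ≤ infDist x Ωᶜ + ⟪gradient (fun y => infDist y Ωᶜ) x, z - x⟫ := by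
  obtain ⟨n, hn1, hn⟩ := hc_geo hΩo hΩconv hΩproper hx
  suffices h : gradient (fun y => infDist y Ωᶜ) x = n by rw [h]; exact ⟨hn1, hn⟩
  have hloc : IsLocalMax (fun z => infDist z Ωᶜ - ⟪n, z⟫) x := by
    filter_upwards [hΩo.mem_nhds hx] with z hz
    have := hn z hz
    rw [inner_sub_right] at this
    linarith
  have h1 : HasFDerivAt (fun z => infDist z Ωᶜ - ⟪n, z⟫)
      (fderiv ℝ (fun y => infDist y Ωᶜ) x - innerSL ℝ n) x :=
    hD.hasFDerivAt.sub (innerSL ℝ n).hasFDerivAt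
  have h2 := hloc.hasFDerivAt_eq_zero h1
  apply (InnerProductSpace.toDual ℝ (EuclideanSpace ℝ (Fin d))).injective
  rw [toDual_gradient, sub_eq_zero.1 h2]
  ext v; simp

theorem hc_line {d : ℕ} {f : EuclideanSpace ℝ (Fin d) → ℝ} {x : EuclideanSpace ℝ (Fin d)}
    (hD : DifferentiableAt ℝ f x) (v : EuclideanSpace ℝ (Fin d)) :
    lineDeriv ℝ f x v = ⟪gradient f x, v⟫ := by
  rw [hD.lineDeriv_eq_fderiv, ← toDual_gradient, InnerProductSpace.toDual_apply_apply]

theorem hc_mono {d : ℕ} {Ω : Set (EuclideanSpace ℝ (Fin d))}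
    (hΩo : IsOpen Ω) (hΩconv : Convex ℝ Ω) (hΩproper : Ω ≠ Set.univ)
    {x v : EuclideanSpace ℝ (Fin d)} {t : ℝ} (ht : 0 < t) (hx : x ∈ Ω) (hx' : x - t • v ∈ Ω)
    (hD : DifferentiableAt ℝ (fun y => infDist y Ωᶜ) x)
    (hD' : DifferentiableAt ℝ (fun y => infDist y Ωᶜ) (x - t • v)) :
    lineDeriv ℝ (fun y => infDist y Ωᶜ) x v ≤
      lineDeriv ℝ (fun y => infDist y Ωᶜ) (x - t • v) v := by
  rw [hc_line hD, hc_line hD']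
  have h1 := (hc_grad hΩo hΩconv hΩproper hx hD).2 _ hx'
  have h2 := (hc_grad hΩo hΩconv hΩproper hx' hD').2 _ hx
  rw [sub_sub_cancel_left, inner_neg_right, inner_smul_right] at h1
  rw [sub_sub_cancel, inner_smul_right] at h2
  have : t * ⟪gradient (fun y => infDist y Ωᶜ) x, v⟫ ≤
    t * ⟪gradient (fun y => infDist y Ωᶜ) (x - t • v), v⟫ := by linarith
  exact le_of_mul_le_mul_left this ht

theorem hc_lineDeriv_zero {d : ℕ} {η : EuclideanSpace ℝ (Fin d) → ℝ}
    {x : EuclideanSpace ℝ (Fin d)} (hx : x ∉ tsupport η) (v : EuclideanSpace ℝ (Fin d)) :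
    lineDeriv ℝ η x v = 0 := by
  have h0 : η =ᶠ[𝓝 x] 0 := notMem_tsupport_iff_eventuallyEq.1 hx
  have h1 : DifferentiableAt ℝ η x :=
    DifferentiableAt.congr_of_eventuallyEq (differentiableAt_const (0 : ℝ)) h0
  rw [h1.lineDeriv_eq_fderiv, h0.fderiv_eq]
  simp

theorem hc_super {d : ℕ} {Ω : Set (EuclideanSpace ℝ (Fin d))}
    (hΩo : IsOpen Ω) (hΩconv : Convex ℝ Ω) (hΩproper : Ω ≠ Set.univ)
    {η : EuclideanSpace ℝ (Fin d) → ℝ} {C : NNReal} (hη : LipschitzWith C η)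
    (hηc : HasCompactSupport η) (hηs : tsupport η ⊆ Ω) (hη0 : ∀ x, 0 ≤ η x)
    (v : EuclideanSpace ℝ (Fin d)) :
    0 ≤ ∫ x, lineDeriv ℝ η x v * lineDeriv ℝ (fun y => infDist y Ωᶜ) x v := by
  have hDL : LipschitzWith 1 (fun y => infDist y Ωᶜ) := lipschitz_infDist_pt Ωᶜ
  set K := cthickening ‖v‖ (tsupport η) with hK
  have hKc : IsCompact K := IsCompact.cthickening hηc
  have hsubK : tsupport η ⊆ K := self_subset_cthickening _
  set g := K.indicator (fun x => lineDeriv ℝ (fun y => infDist y Ωᶜ) x v) with hg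
  have hgi : Integrable g := by
    rw [hg, integrable_indicator_iff hKc.measurableSet]
    exact (hDL.locallyIntegrable_lineDeriv v).integrableOn_isCompact hKc
  have key := hη.integral_inv_smul_sub_mul_tendsto_integral_lineDeriv_mul hgi v
  have heq : ∫ x, lineDeriv ℝ η x v * lineDeriv ℝ (fun y => infDist y Ωᶜ) x v =
      ∫ x, lineDeriv ℝ η x v * g x := by
    congr 1; ext x
    by_cases hx : x ∈ tsupport η
    · rw [hg, indicator_of_mem (hsubK hx)]
    · simp [hc_lineDeriv_zero hx]
  rw [heq]
  obtain ⟨ε, hε, hεs⟩ := hηc.isCompact.exists_cthickening_subset_open hΩo hηs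
  have hcont : Tendsto (fun t : ℝ => t * ‖v‖) (𝓝[>] 0) (𝓝 0) := by
    have : Tendsto (fun t : ℝ => t * ‖v‖) (𝓝 0) (𝓝 (0 * ‖v‖)) :=
      (continuous_id.mul continuous_const).tendsto 0
    rw [zero_mul] at this
    exact this.mono_left nhdsWithin_le_nhds
  refine ge_of_tendsto key ?_
  filter_upwards [Ioc_mem_nhdsGT zero_lt_one, hcont.eventually (gt_mem_nhds hε)] with t ht htε
  have hdiff : ∀ᵐ x, DifferentiableAt ℝ (fun y => infDist y Ωᶜ) x := hDL.ae_differentiableAt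
  have hdiff' : ∀ᵐ x, DifferentiableAt ℝ (fun y => infDist y Ωᶜ) (x - t • v) :=
    (measurePreserving_sub_right volume (t • v)).quasiMeasurePreserving.ae hdiff
  obtain ⟨M, hM⟩ := hηc.exists_bound_of_continuous hη.continuous
  have hi1 : Integrable (fun x => η x * g x) :=
    hgi.bdd_mul hη.continuous.aestronglyMeasurable (Eventually.of_forall hM)
  have hi2 : Integrable (fun x => η (x + t • v) * g x) :=
    hgi.bdd_mul (hη.continuous.comp (continuous_id.add continuous_const)).aestronglyMeasurable
      (Eventually.of_forall fun x => hM _)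
  have hi3 : Integrable (fun x => η x * g (x - t • v)) := by
    simpa using hi2.comp_sub_right (t • v)
  have e1 : ∫ x, (t⁻¹ • (η (x + t • v) - η x)) * g x =
      t⁻¹ * ∫ x, η x * (g (x - t • v) - g x) := by
    have a1 : ∫ x, η (x + t • v) * g x = ∫ x, η x * g (x - t • v) := by
      rw [← integral_sub_right_eq_self _ (t • v)]; simp
    simp only [smul_eq_mul, mul_assoc, mul_sub, sub_mul]
    rw [integral_sub (hi2.const_mul _) (hi1.const_mul _), integral_const_mul, integral_const_mul,
      integral_sub hi3 hi1, a1, mul_sub]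
  rw [e1]
  refine mul_nonneg (inv_nonneg.2 ht.1.le) (integral_nonneg_of_ae ?_)
  filter_upwards [hdiff, hdiff'] with x hx hx'
  by_cases hxs : x ∈ tsupport η
  · have hdist : dist (x - t • v) x = t * ‖v‖ := by
      rw [dist_eq_norm, sub_sub_cancel_left, norm_neg, norm_smul, Real.norm_of_nonneg ht.1.le]
    have m1 : x - t • v ∈ Ω := hεs (mem_cthickening_of_dist_le _ x _ _ hxs (hdist.trans_le htε.le))
    have m2 : x - t • v ∈ K := mem_cthickening_of_dist_le _ x _ _ hxs
      (hdist.trans_le (mul_le_of_le_one_left (norm_nonneg v) ht.2))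
    refine mul_nonneg (hη0 x) ?_
    rw [hg, indicator_of_mem m2, indicator_of_mem (hsubK hxs), sub_nonneg]
    exact hc_mono hΩo hΩconv hΩproper ht.1 (hηs hxs) m1 hx hx'
  · simp [image_eq_zero_of_notMem_tsupport hxs]

theorem hc_super_grad {d : ℕ} {Ω : Set (EuclideanSpace ℝ (Fin d))}
    (hΩo : IsOpen Ω) (hΩconv : Convex ℝ Ω) (hΩproper : Ω ≠ Set.univ)
    {η : EuclideanSpace ℝ (Fin d) → ℝ} {C : NNReal} (hη : LipschitzWith C η)
    (hηc : HasCompactSupport η) (hηs : tsupport η ⊆ Ω) (hη0 : ∀ x, 0 ≤ η x) :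
    Integrable (fun x => ⟪gradient η x, gradient (fun y => infDist y Ωᶜ) x⟫) ∧
    0 ≤ ∫ x, ⟪gradient η x, gradient (fun y => infDist y Ωᶜ) x⟫ := by
  have hDL : LipschitzWith 1 (fun y => infDist y Ωᶜ) := lipschitz_infDist_pt Ωᶜ
  set b := EuclideanSpace.basisFun (Fin d) ℝ
  have hae : (fun x => ∑ i, lineDeriv ℝ η x (b i) * lineDeriv ℝ (fun y => infDist y Ωᶜ) x (b i))
      =ᵐ[volume] (fun x => ⟪gradient η x, gradient (fun y => infDist y Ωᶜ) x⟫) := by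
    filter_upwards [hη.ae_differentiableAt, hDL.ae_differentiableAt] with x h1 h2
    rw [← b.sum_inner_mul_inner]
    refine Finset.sum_congr rfl fun i _ => ?_
    rw [hc_line h1, hc_line h2, real_inner_comm (b i) (gradient (fun y => infDist y Ωᶜ) x)]
  have hi : ∀ i ∈ Finset.univ, Integrable
      (fun x => lineDeriv ℝ η x (b i) * lineDeriv ℝ (fun y => infDist y Ωᶜ) x (b i)) := by
    intro i _
    have h1 : Integrable (fun x => lineDeriv ℝ η x (b i)) := by
      have : (fun x => lineDeriv ℝ η x (b i)) =
          (tsupport η).indicator (fun x => lineDeriv ℝ η x (b i)) := by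
        ext x
        by_cases hx : x ∈ tsupport η
        · rw [indicator_of_mem hx]
        · rw [indicator_of_notMem hx, hc_lineDeriv_zero hx]
      rw [this, integrable_indicator_iff (isClosed_tsupport η).measurableSet]
      exact (hη.locallyIntegrable_lineDeriv _).integrableOn_isCompact hηc
    exact h1.mul_bdd (c := 1 * ‖b i‖) (aestronglyMeasurable_lineDeriv hDL.continuous _)
      (Eventually.of_forall fun x => norm_lineDeriv_le_of_lipschitz ℝ hDL)
  refine ⟨(integrable_finsetSum _ hi).congr hae, ?_⟩
  rw [← integral_congr_ae hae, integral_finsetSum _ hi]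
  exact Finset.sum_nonneg fun i _ => hc_super hΩo hΩconv hΩproper hη hηc hηs hη0 _

theorem hc_h {p δ δ' s : ℝ} (hs : 0 < s) :
    ∃ h', HasDerivAt (fun s : ℝ => s ^ δ * (1 + s) ^ (δ' - δ) * s ^ (1 - p)) h' s ∧
      h' ≤ -(p - 1 - max δ δ') * (s ^ δ * (1 + s) ^ (δ' - δ) * s ^ (-p)) := by
  have h1s : 0 < 1 + s := by linarith
  have d1 : HasDerivAt (fun s : ℝ => s ^ δ) (δ * s ^ (δ - 1)) s :=
    Real.hasDerivAt_rpow_const (Or.inl hs.ne')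
  have d2 : HasDerivAt (fun s : ℝ => (1 + s) ^ (δ' - δ)) (1 * (δ' - δ) * (1 + s) ^ (δ' - δ - 1)) s :=
    ((hasDerivAt_id s).const_add 1).rpow_const (Or.inl h1s.ne')
  have d3 : HasDerivAt (fun s : ℝ => s ^ (1 - p)) ((1 - p) * s ^ (1 - p - 1)) s :=
    Real.hasDerivAt_rpow_const (Or.inl hs.ne')
  refine ⟨_, (d1.mul d2).mul d3, ?_⟩
  have e1 : s ^ (δ - 1) = s ^ δ / s := Real.rpow_sub_one hs.ne' _
  have e2 : (1 + s) ^ (δ' - δ - 1) = (1 + s) ^ (δ' - δ) / (1 + s) := Real.rpow_sub_one h1s.ne' _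
  have e3 : s ^ (1 - p - 1) = s ^ (-p) := by congr 1; ring
  have e4 : s ^ (1 - p) = s * s ^ (-p) := by
    rw [sub_eq_add_neg, Real.rpow_add hs, Real.rpow_one]
  rw [e1, e2, e3, e4]
  have hc : 0 < s ^ δ * (1 + s) ^ (δ' - δ) * s ^ (-p) := by positivity
  have hm : (δ + δ' * s) / (1 + s) ≤ max δ δ' := by
    rw [div_le_iff₀ h1s]
    nlinarith [le_max_left δ δ', le_max_right δ δ']
  have : (δ * (s ^ δ / s) * (1 + s) ^ (δ' - δ) +
      s ^ δ * (1 * (δ' - δ) * ((1 + s) ^ (δ' - δ) / (1 + s)))) * (s * s ^ (-p)) +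
      s ^ δ * (1 + s) ^ (δ' - δ) * ((1 - p) * s ^ (-p)) =
      ((δ + δ' * s) / (1 + s) + 1 - p) * (s ^ δ * (1 + s) ^ (δ' - δ) * s ^ (-p)) := by
    field_simp; ring
  calc _ = _ := this
    _ ≤ _ := by
      apply mul_le_mul_of_nonneg_right _ hc.le
      linarith

theorem hc_young {p X w : ℝ} (hp : 1 < p) (hX : 0 ≤ X) (hw : 0 ≤ w) :
    p * (X ^ (p - 1) * w) ≤ (p - 1) * X ^ p + w ^ p := by
  have hp1 : p - 1 ≠ 0 := by linarith
  have hp0 : (0:ℝ) < p := by linarith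
  have h := Real.young_inequality_of_nonneg hw (Real.rpow_nonneg hX (p - 1))
    (Real.HolderConjugate.conjExponent hp)
  rw [← Real.rpow_mul hX, Real.conjExponent, mul_div_cancel₀ _ hp1] at h
  have h2 := mul_le_mul_of_nonneg_left h hp0.le
  have : p * (w ^ p / p + X ^ p / (p / (p - 1))) = (p - 1) * X ^ p + w ^ p := by
    field_simp; ring
  linarith

theorem hc_pt {p m s c f G h' : ℝ} (hp : 1 < p) (hm : 0 < p - 1 - m) (hs : 0 < s) (hc : 0 ≤ c)
    (hh : h' ≤ -(p - 1 - m) * (c * s ^ (-p))) :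
    ((p - 1 - m) / p) ^ (p - 1) * (h' * |f| ^ p + (c * s ^ (1 - p)) * (p * |f| ^ (p - 2) * f * G))
      ≤ c * |G| ^ p - ((p - 1 - m) / p) ^ p * (c * s ^ (-p) * |f| ^ p) := by
  have hp0 : (0:ℝ) < p := by linarith
  set κ := (p - 1 - m) / p with hκ
  have hκ0 : 0 < κ := by positivity
  have hκm : p - 1 - m = p * κ := by rw [hκ]; field_simp
  have hy := hc_young hp (X := κ * |f| / s) (w := |G|) (by positivity) (abs_nonneg _)
  have x1 : (κ * |f| / s) ^ (p - 1) = κ ^ (p - 1) * |f| ^ (p - 1) * s ^ (1 - p) := by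
    rw [Real.div_rpow (by positivity) hs.le, Real.mul_rpow hκ0.le (abs_nonneg _),
      show 1 - p = -(p - 1) by ring, Real.rpow_neg hs.le, div_eq_mul_inv]
  have x2 : (κ * |f| / s) ^ p = κ ^ p * |f| ^ p * s ^ (-p) := by
    rw [Real.div_rpow (by positivity) hs.le, Real.mul_rpow hκ0.le (abs_nonneg _),
      Real.rpow_neg hs.le, div_eq_mul_inv]
  rw [x1, x2] at hy
  have x3 : κ ^ p = κ ^ (p - 1) * κ := by
    rw [Real.rpow_sub_one hκ0.ne']; field_simp
  have x4 : |f| ^ (p - 2) * f * G ≤ |f| ^ (p - 1) * |G| := by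
    rcases eq_or_ne f 0 with rfl | hf
    · simp only [mul_zero, zero_mul]; positivity
    · have hf0 : 0 < |f| := abs_pos.2 hf
      have : |f| ^ (p - 1) = |f| ^ (p - 2) * |f| := by
        rw [show p - 1 = (p - 2) + 1 by ring, Real.rpow_add_one hf0.ne']
      rw [this, mul_assoc, mul_assoc, ← abs_mul]
      exact mul_le_mul_of_nonneg_left (le_abs_self _) (by positivity)
  have hF : 0 ≤ |f| ^ p := by positivity
  have hk1 : 0 ≤ κ ^ (p - 1) := by positivity
  have b1 : h' * |f| ^ p ≤ -(p * κ) * (c * s ^ (-p)) * |f| ^ p := by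
    rw [hκm] at hh
    exact mul_le_mul_of_nonneg_right hh hF
  have b2 : (c * s ^ (1 - p)) * (p * |f| ^ (p - 2) * f * G) ≤
      (c * s ^ (1 - p)) * (p * (|f| ^ (p - 1) * |G|)) := by
    apply mul_le_mul_of_nonneg_left _ (by positivity)
    calc p * |f| ^ (p - 2) * f * G = p * (|f| ^ (p - 2) * f * G) := by ring
      _ ≤ _ := mul_le_mul_of_nonneg_left x4 hp0.le
  have b3 := mul_le_mul_of_nonneg_left (add_le_add b1 b2) hk1
  have b4 := mul_le_mul_of_nonneg_left hy hc
  rw [x3] at b4 ⊢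
  refine b3.trans ?_
  linarith

theorem hc_lip {d : ℕ} {D ψ : EuclideanSpace ℝ (Fin d) → ℝ} {h : ℝ → ℝ} {C : NNReal}
    (hD : LipschitzWith 1 D) (hψ : LipschitzWith C ψ) (hψc : HasCompactSupport ψ)
    (hpos : ∀ x ∈ tsupport ψ, 0 < D x) (hh : ContDiffOn ℝ 1 h (Ioi 0)) :
    ∃ C', LipschitzWith C' (fun x => h (D x) * ψ x) := by
  obtain ⟨ε, hε, hεD⟩ := hψc.isCompact.exists_forall_le' hD.continuous.continuousOn hpos
  obtain ⟨M, hM⟩ := hψc.isCompact.exists_bound_of_continuousOn hD.continuous.continuousOn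
  set N := max ε M
  have hεN : ε ≤ N := le_max_left _ _
  have hsub : Icc ε N ⊆ Ioi 0 := fun s hs => lt_of_lt_of_le hε hs.1
  obtain ⟨L, hL⟩ : ∃ L, LipschitzOnWith L h (Icc ε N) :=
    (hh.mono hsub).exists_lipschitzOnWith one_ne_zero (convex_Icc _ _) isCompact_Icc
  obtain ⟨B, hB⟩ := isCompact_Icc.exists_bound_of_continuousOn (hh.continuousOn.mono hsub)
  obtain ⟨P, hP⟩ := hψc.exists_bound_of_continuous hψ.continuous
  set H : EuclideanSpace ℝ (Fin d) → ℝ := fun x => h (projIcc ε N hεN (D x)) with hH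
  have hHL : LipschitzWith (L * (1 * 1)) H :=
    hL.to_restrict.comp ((LipschitzWith.projIcc hεN).comp hD)
  have hHB : ∀ x, |H x| ≤ B := fun x => hB _ (projIcc ε N hεN (D x)).2
  have heq : (fun x => h (D x) * ψ x) = fun x => H x * ψ x := by
    ext x
    by_cases hx : x ∈ tsupport ψ
    · have : D x ∈ Icc ε N := ⟨hεD x hx, (le_abs_self _).trans ((hM x hx).trans (le_max_right _ _))⟩
      simp only [hH, projIcc_of_mem hεN this]
    · simp [image_eq_zero_of_notMem_tsupport hx]
  rw [heq]
  refine ⟨Real.toNNReal (B * C + P * (L * (1 * 1))), LipschitzWith.of_dist_le_mul fun x y => ?_⟩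
  have hB0 : 0 ≤ B := (abs_nonneg _).trans (hHB x)
  have hP0 : 0 ≤ P := (norm_nonneg _).trans (hP x)
  have l1 := hHL.dist_le_mul x y
  have l2 := hψ.dist_le_mul x y
  rw [Real.coe_toNNReal _ (by positivity)]
  rw [Real.dist_eq] at l1 l2 ⊢
  have : H x * ψ x - H y * ψ y = H x * (ψ x - ψ y) + ψ y * (H x - H y) := by ring
  rw [this]
  refine (abs_add_le _ _).trans ?_
  rw [abs_mul, abs_mul, add_mul, mul_assoc, mul_assoc]
  push_cast at l1
  exact add_le_add (mul_le_mul (hHB x) l2 (abs_nonneg _) hB0)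
    (mul_le_mul (hP y) l1 (abs_nonneg _) hP0)

theorem hc_grad_zero {d : ℕ} {η : EuclideanSpace ℝ (Fin d) → ℝ}
    {x : EuclideanSpace ℝ (Fin d)} (hx : x ∉ tsupport η) : gradient η x = 0 := by
  have h0 : η =ᶠ[𝓝 x] 0 := notMem_tsupport_iff_eventuallyEq.1 hx
  rw [gradient, h0.fderiv_eq]
  simp

theorem hc_grad_le {d : ℕ} {D : EuclideanSpace ℝ (Fin d) → ℝ} (hD : LipschitzWith 1 D)
    (x : EuclideanSpace ℝ (Fin d)) : ‖gradient D x‖ ≤ 1 := by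
  rw [gradient, LinearIsometryEquiv.norm_map]
  simpa using norm_fderiv_le_of_lipschitz ℝ (x₀ := x) hD

theorem hc_grad_meas {d : ℕ} {D : EuclideanSpace ℝ (Fin d) → ℝ} :
    Measurable (fun x => gradient D x) :=
  (InnerProductSpace.toDual ℝ (EuclideanSpace ℝ (Fin d))).symm.continuous.measurable.comp
    (measurable_fderiv ℝ D)

/-- Weighted Hardy inequality on a convex set, for functions supported away from the
skeleton (Proposition 2.4 of the paper). -/
theorem hardy_inequality_convex_set
    (d : ℕ) (hd : 1 ≤ d) (Ω : Set (EuclideanSpace ℝ (Fin d)))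
    (hΩo : IsOpen Ω) (hΩconv : Convex ℝ Ω) (hΩne : Ω.Nonempty) (hΩproper : Ω ≠ Set.univ)
    (p δ δ' : ℝ) (hp : 1 < p) (hδ : 0 ≤ δ) (hδ' : 0 ≤ δ')
    (hcond : 0 < p - 1 - max δ δ')
    (φ : EuclideanSpace ℝ (Fin d) → ℝ) (hφ : ContDiff ℝ 1 φ)
    (hφc : HasCompactSupport φ) (hφs : tsupport φ ⊆ Ω ∩ goodSet Ω) :
    (∫ x in Ω, (Metric.infDist x Ωᶜ ^ δ * (1 + Metric.infDist x Ωᶜ) ^ (δ' - δ)) *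
        ‖gradient φ x‖ ^ p)
      ≥ (∫ x in Ω, (Metric.infDist x Ωᶜ ^ δ * (1 + Metric.infDist x Ωᶜ) ^ (δ' - δ)) *
          |⟪gradient (fun y => Metric.infDist y Ωᶜ) x, gradient φ x⟫| ^ p)
    ∧ (∫ x in Ω, (Metric.infDist x Ωᶜ ^ δ * (1 + Metric.infDist x Ωᶜ) ^ (δ' - δ)) *
          |⟪gradient (fun y => Metric.infDist y Ωᶜ) x, gradient φ x⟫| ^ p)
      ≥ ((p - 1 - max δ δ') / p) ^ p *
        (∫ x in Ω, (Metric.infDist x Ωᶜ ^ δ * (1 + Metric.infDist x Ωᶜ) ^ (δ' - δ)) *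
          Metric.infDist x Ωᶜ ^ (-p) * |φ x| ^ p) := by
  have hp0 : (0:ℝ) < p := by linarith
  have hDL : LipschitzWith 1 (fun y => infDist y Ωᶜ) := lipschitz_infDist_pt Ωᶜ
  have hDc : Continuous (fun y => infDist y Ωᶜ) := hDL.continuous
  have hne : (Ωᶜ).Nonempty := Set.nonempty_compl.2 hΩproper
  have hKΩ : tsupport φ ⊆ Ω := fun x hx => (hφs hx).1
  have hK : IsCompact (tsupport φ) := hφc
  have hKm : MeasurableSet (tsupport φ) := (isClosed_tsupport φ).measurableSet
  have hDpos : ∀ x ∈ Ω, 0 < infDist x Ωᶜ := fun x hx =>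
    (hΩo.isClosed_compl.notMem_iff_infDist_pos hne).1 (fun h => h hx)
  have hD0 : ∀ x, 0 ≤ infDist x Ωᶜ := fun x => infDist_nonneg
  have hgc : Continuous (fun x => gradient φ x) :=
    (InnerProductSpace.toDual ℝ (EuclideanSpace ℝ (Fin d))).symm.continuous.comp
      (hφ.continuous_fderiv one_ne_zero)
  have hcnn : ∀ x, 0 ≤ infDist x Ωᶜ ^ δ * (1 + infDist x Ωᶜ) ^ (δ' - δ) := fun x =>
    mul_nonneg (Real.rpow_nonneg (hD0 x) _) (Real.rpow_nonneg (by linarith [hD0 x]) _)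
  have hcc : ContinuousOn (fun x => infDist x Ωᶜ ^ δ * (1 + infDist x Ωᶜ) ^ (δ' - δ))
      (tsupport φ) := by
    refine ContinuousOn.mul (hDc.continuousOn.rpow_const fun x hx => Or.inl (hDpos x (hKΩ hx)).ne')
      ((continuous_const.add hDc).continuousOn.rpow_const fun x hx => Or.inl ?_)
    exact (show (0:ℝ) < 1 + infDist x Ωᶜ by linarith [hD0 x]).ne'
  have hcm : Measurable (fun x => infDist x Ωᶜ ^ δ * (1 + infDist x Ωᶜ) ^ (δ' - δ)) :=
    (hDc.measurable.pow_const _).mul ((hDc.measurable.const_add 1).pow_const _)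
  -- restrict all integrals to the support
  have r1 : ∫ x in Ω, (infDist x Ωᶜ ^ δ * (1 + infDist x Ωᶜ) ^ (δ' - δ)) * ‖gradient φ x‖ ^ p =
      ∫ x in tsupport φ, (infDist x Ωᶜ ^ δ * (1 + infDist x Ωᶜ) ^ (δ' - δ)) *
        ‖gradient φ x‖ ^ p := by
    refine setIntegral_eq_of_subset_of_forall_sdiff_eq_zero hΩo.measurableSet hKΩ fun x hx => ?_
    rw [hc_grad_zero hx.2, norm_zero, Real.zero_rpow hp0.ne', mul_zero]
  have r2 : ∫ x in Ω, (infDist x Ωᶜ ^ δ * (1 + infDist x Ωᶜ) ^ (δ' - δ)) *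
          |⟪gradient (fun y => infDist y Ωᶜ) x, gradient φ x⟫| ^ p =
      ∫ x in tsupport φ, (infDist x Ωᶜ ^ δ * (1 + infDist x Ωᶜ) ^ (δ' - δ)) *
          |⟪gradient (fun y => infDist y Ωᶜ) x, gradient φ x⟫| ^ p := by
    refine setIntegral_eq_of_subset_of_forall_sdiff_eq_zero hΩo.measurableSet hKΩ fun x hx => ?_
    rw [hc_grad_zero hx.2, inner_zero_right, abs_zero, Real.zero_rpow hp0.ne', mul_zero]
  have r3 : ∫ x in Ω, (infDist x Ωᶜ ^ δ * (1 + infDist x Ωᶜ) ^ (δ' - δ)) *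
          infDist x Ωᶜ ^ (-p) * |φ x| ^ p =
      ∫ x in tsupport φ, (infDist x Ωᶜ ^ δ * (1 + infDist x Ωᶜ) ^ (δ' - δ)) *
          infDist x Ωᶜ ^ (-p) * |φ x| ^ p := by
    refine setIntegral_eq_of_subset_of_forall_sdiff_eq_zero hΩo.measurableSet hKΩ fun x hx => ?_
    rw [image_eq_zero_of_notMem_tsupport hx.2, abs_zero, Real.zero_rpow hp0.ne', mul_zero]
  have i1 : IntegrableOn (fun x => (infDist x Ωᶜ ^ δ * (1 + infDist x Ωᶜ) ^ (δ' - δ)) *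
      ‖gradient φ x‖ ^ p) (tsupport φ) :=
    (hcc.mul (hgc.norm.continuousOn.rpow_const fun x _ => Or.inr hp0.le)).integrableOn_compact hK
  have hle : ∀ x, (infDist x Ωᶜ ^ δ * (1 + infDist x Ωᶜ) ^ (δ' - δ)) *
          |⟪gradient (fun y => infDist y Ωᶜ) x, gradient φ x⟫| ^ p ≤
        (infDist x Ωᶜ ^ δ * (1 + infDist x Ωᶜ) ^ (δ' - δ)) * ‖gradient φ x‖ ^ p := by
    intro x
    refine mul_le_mul_of_nonneg_left (Real.rpow_le_rpow (abs_nonneg _) ?_ hp0.le) (hcnn x)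
    refine (abs_real_inner_le_norm _ _).trans ?_
    exact mul_le_of_le_one_left (norm_nonneg _) (hc_grad_le hDL x)
  have i2 : IntegrableOn (fun x => (infDist x Ωᶜ ^ δ * (1 + infDist x Ωᶜ) ^ (δ' - δ)) *
          |⟪gradient (fun y => infDist y Ωᶜ) x, gradient φ x⟫| ^ p) (tsupport φ) := by
    refine Integrable.mono' i1 ?_ (Eventually.of_forall fun x => ?_)
    · have hm : Measurable (fun x => ⟪gradient (fun y => infDist y Ωᶜ) x, gradient φ x⟫) :=
        hc_grad_meas.inner hgc.measurable
      exact (hcm.mul (hm.abs.pow_const _)).aestronglyMeasurable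
    · rw [Real.norm_of_nonneg (mul_nonneg (hcnn x) (by positivity))]
      exact hle x
  have i3 : IntegrableOn (fun x => (infDist x Ωᶜ ^ δ * (1 + infDist x Ωᶜ) ^ (δ' - δ)) *
          infDist x Ωᶜ ^ (-p) * |φ x| ^ p) (tsupport φ) :=
    ((hcc.mul (hDc.continuousOn.rpow_const fun x hx => Or.inl (hDpos x (hKΩ hx)).ne')).mul
      (hφ.continuous.abs.continuousOn.rpow_const fun x _ => Or.inr hp0.le)).integrableOn_compact hK
  rw [r1, r2, r3]
  refine ⟨integral_mono i2 i1 hle, ?_⟩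
  -- the test function
  set h : ℝ → ℝ := fun s => s ^ δ * (1 + s) ^ (δ' - δ) * s ^ (1 - p) with hh
  set ψ : EuclideanSpace ℝ (Fin d) → ℝ := fun x => |φ x| ^ p with hψ
  have hψd : ContDiff ℝ 1 ψ := by simpa [hψ] using hφ.norm_rpow hp
  have hψs0 : Function.support ψ ⊆ Function.support φ := by
    intro x hx hx0
    apply hx
    simp only [hψ, hx0, abs_zero, Real.zero_rpow hp0.ne']
  have hψs : tsupport ψ ⊆ tsupport φ := closure_mono hψs0
  have hψc : HasCompactSupport ψ := hK.of_isClosed_subset (isClosed_tsupport _) hψs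
  obtain ⟨C, hψL⟩ := hψd.lipschitzWith_of_hasCompactSupport hψc one_ne_zero
  have hhd : ContDiffOn ℝ 1 h (Ioi 0) := by
    intro s hs
    have hs0 : s ≠ 0 := ne_of_gt hs
    have hs1 : 1 + s ≠ 0 := by have : 0 < s := hs; linarith
    exact (((contDiffAt_id.rpow_const_of_ne hs0).mul
      ((contDiffAt_const.add contDiffAt_id).rpow_const_of_ne hs1)).mul
      (contDiffAt_id.rpow_const_of_ne hs0)).contDiffWithinAt
  obtain ⟨C', hηL⟩ := hc_lip hDL hψL hψc (fun x hx => hDpos x (hKΩ (hψs hx))) hhd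
  set η : EuclideanSpace ℝ (Fin d) → ℝ := fun x => h (infDist x Ωᶜ) * ψ x with hη
  have hηs : tsupport η ⊆ tsupport φ :=
    (closure_mono (Function.support_mul_subset_right _ _)).trans hψs
  have hηc : HasCompactSupport η := hK.of_isClosed_subset (isClosed_tsupport _) hηs
  have hη0 : ∀ x, 0 ≤ η x := fun x =>
    mul_nonneg (mul_nonneg (hcnn x) (Real.rpow_nonneg (hD0 x) _)) (by positivity)
  obtain ⟨iη, hηint⟩ := hc_super_grad hΩo hΩconv hΩproper hηL hηc (hηs.trans hKΩ) hη0
  have hηK : ∫ x in tsupport φ, ⟪gradient η x, gradient (fun y => infDist y Ωᶜ) x⟫ =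
      ∫ x, ⟪gradient η x, gradient (fun y => infDist y Ωᶜ) x⟫ := by
    refine setIntegral_eq_integral_of_forall_compl_eq_zero fun x hx => ?_
    rw [hc_grad_zero (fun h => hx (hηs h)), inner_zero_left]
  have hpt : ∀ᵐ x, x ∈ tsupport φ →
      ((p - 1 - max δ δ') / p) ^ (p - 1) * ⟪gradient η x, gradient (fun y => infDist y Ωᶜ) x⟫ ≤
      (infDist x Ωᶜ ^ δ * (1 + infDist x Ωᶜ) ^ (δ' - δ)) *
          |⟪gradient (fun y => infDist y Ωᶜ) x, gradient φ x⟫| ^ p -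
      ((p - 1 - max δ δ') / p) ^ p * ((infDist x Ωᶜ ^ δ * (1 + infDist x Ωᶜ) ^ (δ' - δ)) *
          infDist x Ωᶜ ^ (-p) * |φ x| ^ p) := by
    filter_upwards [hDL.ae_differentiableAt] with x hx hxK
    have hs := hDpos x (hKΩ hxK)
    obtain ⟨h', hd', hle'⟩ := hc_h (p := p) (δ := δ) (δ' := δ') hs
    have hn := (hc_grad hΩo hΩconv hΩproper (hKΩ hxK) hx).1
    set u := gradient (fun y => infDist y Ωᶜ) x with hu
    have f1 : HasFDerivAt (fun y => h (infDist y Ωᶜ))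
        (h' • fderiv ℝ (fun y => infDist y Ωᶜ) x) x :=
      HasDerivAt.comp_hasFDerivAt (h₂ := h) x hd' hx.hasFDerivAt
    have f2 : HasFDerivAt ψ ((p * |φ x| ^ (p - 2) * φ x) • fderiv ℝ φ x) x :=
      (hasDerivAt_abs_rpow (φ x) hp).comp_hasFDerivAt x
        ((hφ.differentiable one_ne_zero) x).hasFDerivAt
    have f3 := (f1.mul f2).fderiv
    have e0 : ⟪gradient η x, u⟫ = fderiv ℝ η x u := by
      rw [← toDual_gradient, InnerProductSpace.toDual_apply_apply]
    have e1 : fderiv ℝ (fun y => infDist y Ωᶜ) x u = 1 := by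
      rw [← toDual_gradient, InnerProductSpace.toDual_apply_apply, ← hu,
        real_inner_self_eq_norm_sq, hn, one_pow]
    have e2 : fderiv ℝ φ x u = ⟪u, gradient φ x⟫ := by
      rw [← toDual_gradient, InnerProductSpace.toDual_apply_apply, real_inner_comm]
    have e3 : ⟪gradient η x, u⟫ = h' * |φ x| ^ p +
        (infDist x Ωᶜ ^ δ * (1 + infDist x Ωᶜ) ^ (δ' - δ) * infDist x Ωᶜ ^ (1 - p)) *
          (p * |φ x| ^ (p - 2) * φ x * ⟪u, gradient φ x⟫) := by
      rw [e0, ← e2]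
      refine (DFunLike.congr_fun f3 u).trans ?_
      simp only [ContinuousLinearMap.add_apply, ContinuousLinearMap.smul_apply, smul_eq_mul, e1,
        hh, hψ]
      ring
    rw [e3]
    exact hc_pt hp hcond hs (hcnn x) hle'
  have fin : ∫ x in tsupport φ, ((p - 1 - max δ δ') / p) ^ (p - 1) *
      ⟪gradient η x, gradient (fun y => infDist y Ωᶜ) x⟫ ≤ ∫ x in tsupport φ,
      ((infDist x Ωᶜ ^ δ * (1 + infDist x Ωᶜ) ^ (δ' - δ)) *
          |⟪gradient (fun y => infDist y Ωᶜ) x, gradient φ x⟫| ^ p -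
      ((p - 1 - max δ δ') / p) ^ p * ((infDist x Ωᶜ ^ δ * (1 + infDist x Ωᶜ) ^ (δ' - δ)) *
          infDist x Ωᶜ ^ (-p) * |φ x| ^ p)) :=
    setIntegral_mono_on_ae (iη.integrableOn.const_mul _) (i2.sub (i3.const_mul _)) hKm hpt
  rw [integral_sub i2 (i3.const_mul _), integral_const_mul, integral_const_mul, hηK] at fin
  have hnn : 0 ≤ ((p - 1 - max δ δ') / p) ^ (p - 1) *
      ∫ x, ⟪gradient η x, gradient (fun y => infDist y Ωᶜ) x⟫ :=
    mul_nonneg (by positivity) hηint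
  linarith
end
end
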